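/- arXiv:2101.09319 — 7 statements merged into one kernel-verified Lean document; each statement's English description precedes it below -/
import Mathlib

section
/- Let n ≥ 1 and let α be a chord diagram of order n whose interlacement graph is connected. If all partial duals of the one-vertex ribbon graph of α have the same genus, i.e. g(α, A) = g(α, ∅) for every set A of chords of α, then n is odd and α x = x + n for every x ∈ ZMod (2n) (that is, α is the diagram B_n with n odd). (This is the one-vertex form of the main theorem: every connected ribbon graph has a one-vertex partial dual, so a join-prime ribbon graph which is not a partial dual of some B_n with n odd has partial duals of different genera.) -/
open scoped Classical

/-- The first point of `S` among `y + 1, y + 2, …` (equal to `y` if no such point exists). -/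
noncomputable def firstAfter (n : ℕ) (S : Set (ZMod (2 * n))) (y : ZMod (2 * n)) : ZMod (2 * n) :=
  if h : ∃ k : ℕ, 0 < k ∧ y + (k : ZMod (2 * n)) ∈ S then y + (Nat.find h : ZMod (2 * n)) else y

/-- One step of the boundary permutation `π_A` of the endpoint set `S`:
`x ∈ S` goes to the first point of `S` among `α x + 1, α x + 2, …`. -/
def boundaryStep (n : ℕ) (α : Equiv.Perm (ZMod (2 * n))) (S : Set (ZMod (2 * n)))
    (x y : ZMod (2 * n)) : Prop :=
  x ∈ S ∧ y = firstAfter n S (α x)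

/-- `c(A)`: the number of orbits of `π_A` on the endpoint set `S`, with `c(∅) = 1`. -/
noncomputable def orbitCount (n : ℕ) (α : Equiv.Perm (ZMod (2 * n))) (S : Set (ZMod (2 * n))) : ℕ :=
  if S = ∅ then 1
  else ((fun x => {y | Relation.EqvGen (boundaryStep n α S) x y}) '' S).ncard

/-- The genus `g(α, A) = (2 + n − c(A) − c(Aᶜ))/2` of the partial dual relative to the
set of chords with endpoint set `S`. -/
noncomputable def pdGenus (n : ℕ) (α : Equiv.Perm (ZMod (2 * n))) (S : Set (ZMod (2 * n))) : ℕ :=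
  (2 + n - orbitCount n α S - orbitCount n α Sᶜ) / 2

/-- The chords `{x, α x}` and `{y, α y}` interlace: writing `α x = x + m`, exactly one of
`y, α y` lies in the cyclic interval `{x + k : 1 ≤ k ≤ m − 1}`. -/
def Interlaces (n : ℕ) (α : Equiv.Perm (ZMod (2 * n))) (x y : ZMod (2 * n)) : Prop :=
  Xor' (0 < (y - x).val ∧ (y - x).val < (α x - x).val)
       (0 < (α y - x).val ∧ (α y - x).val < (α x - x).val)

/-- The interlacement graph of `α`: vertices are the chords, adjacency is interlacement. -/
def interGraph (n : ℕ) (α : Equiv.Perm (ZMod (2 * n))) :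
    SimpleGraph {p : Sym2 (ZMod (2 * n)) // ∃ x, p = s(x, α x)} :=
  SimpleGraph.fromRel (fun c d => ∃ x y, c.1 = s(x, α x) ∧ d.1 = s(y, α y) ∧ Interlaces n α x y)

/-- The partial-dual genus polynomial `∂Γ_α(z) = Σ_{A ⊆ chords} z^{g(α,A)}`, the sum running
over the α-invariant endpoint sets. -/
noncomputable def pdPoly (n : ℕ) (hn : n ≠ 0) (α : Equiv.Perm (ZMod (2 * n))) : Polynomial ℕ :=
  haveI : NeZero (2 * n) := ⟨by omega⟩
  ∑ S : Finset (ZMod (2 * n)),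
    if (∀ x ∈ S, α x ∈ S) then Polynomial.X ^ pdGenus n α (↑S) else 0

/-- The face permutation `ρ ∘ α : x ↦ α x + 1`, whose orbits are the faces of the
one-vertex ribbon graph of `α`. -/
def faceMap (n : ℕ) (α : Equiv.Perm (ZMod (2 * n))) : Equiv.Perm (ZMod (2 * n)) :=
  α.trans (Equiv.addRight 1)

/-- The face (orbit of `ρ ∘ α`) containing a point `z`. -/
def faceOrbit (n : ℕ) (α : Equiv.Perm (ZMod (2 * n))) (z : ZMod (2 * n)) : Set (ZMod (2 * n)) :=
  {w | (faceMap n α).SameCycle z w}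

/-- The number of faces of the one-vertex ribbon graph of `α`:
the number of orbits of `ρ ∘ α`. -/
noncomputable def numFaces (n : ℕ) (α : Equiv.Perm (ZMod (2 * n))) : ℕ :=
  (Set.range (faceOrbit n α)).ncard

/-- The chord diagram `B_n`: the involution `x ↦ x + n` of `ZMod (2n)`, all of whose
chords are pairwise interlacing. -/
def bn (n : ℕ) : Equiv.Perm (ZMod (2 * n)) :=
  Equiv.addRight (n : ZMod (2 * n))


namespace GMT

noncomputable def cyc {X : Type*} (P : Equiv.Perm X) : ℕ :=
  Nat.card (Quotient (Equiv.Perm.SameCycle.setoid P))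

def mk {X : Type*} (P : Equiv.Perm X) (x : X) : Quotient (Equiv.Perm.SameCycle.setoid P) :=
  Quotient.mk _ x

lemma mk_eq {X : Type*} (P : Equiv.Perm X) (x y : X) : mk P x = mk P y ↔ P.SameCycle x y :=
  Quotient.eq (r := Equiv.Perm.SameCycle.setoid P)

lemma mk_apply {X : Type*} (P : Equiv.Perm X) (x : X) : mk P (P x) = mk P x := by
  rw [mk_eq]; exact Equiv.Perm.sameCycle_apply_left.2 (Equiv.Perm.SameCycle.refl _ _)

lemma mk_surj {X : Type*} (P : Equiv.Perm X) (q) : ∃ x, mk P x = q := Quotient.exists_rep q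

/-- A function invariant under `P` is constant on cycles. -/
lemma const_of_inv {X Y : Type*} [Finite X] (P : Equiv.Perm X) (f : X → Y)
    (hf : ∀ x, f (P x) = f x) {x y : X} (h : mk P x = mk P y) : f x = f y := by
  rw [mk_eq] at h
  obtain ⟨i, hi⟩ := h.exists_pow_eq'
  obtain ⟨-, rfl⟩ := hi
  have : ∀ k : ℕ, f ((P ^ k) x) = f x := by
    intro k
    induction k with
    | zero => rfl
    | succ k ih => rw [pow_succ', Equiv.Perm.mul_apply, hf, ih]
  exact (this _).symm

lemma same_after {X : Type*} [Finite X] [DecidableEq X] (P : Equiv.Perm X) {a b : X}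
    (h : mk P a ≠ mk P b) : mk (P * Equiv.swap a b) a = mk (P * Equiv.swap a b) b := by
  by_contra hc
  set Q := P * Equiv.swap a b with hQ
  have key : ∀ i : ℕ, mk Q ((P ^ (i+1)) a) = mk Q b := by
    intro i
    induction i with
    | zero =>
      have : Q b = P a := by simp [hQ]
      rw [← mk_apply Q b, this]; simp
    | succ i ih =>
      have h1 : (P ^ (i+1)) a ≠ a := by
        intro h2; rw [h2] at ih; exact hc ih
      have h2 : (P ^ (i+1)) a ≠ b := by
        intro h2; apply h; rw [mk_eq]; exact ⟨(i+1 : ℕ), by rw [zpow_natCast]; exact h2⟩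
      have : Q ((P ^ (i+1)) a) = (P ^ (i+1+1)) a := by
        rw [hQ, Equiv.Perm.mul_apply, Equiv.swap_apply_of_ne_of_ne h1 h2, pow_succ' P (i+1)]; rfl
      rw [← this, mk_apply, ih]
  have ho : 0 < orderOf P := orderOf_pos P
  have := key (orderOf P - 1)
  rw [Nat.sub_add_cancel ho, pow_orderOf_eq_one] at this
  exact hc this

lemma diff_after {X : Type*} [Finite X] [DecidableEq X] (P : Equiv.Perm X) {a b : X} (hab : a ≠ b)
    (h : mk P a = mk P b) : mk (P * Equiv.swap a b) a ≠ mk (P * Equiv.swap a b) b := by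
  intro hc
  set Q := P * Equiv.swap a b with hQ
  have hex : ∃ k : ℕ, 0 < k ∧ (P ^ k) a = b := by
    rw [mk_eq] at h
    obtain ⟨i, h1, -, h2⟩ := h.exists_pow_eq''
    exact ⟨i, h1, h2⟩
  set k := Nat.find hex with hk
  obtain ⟨hk0, hkb⟩ := Nat.find_spec hex
  have hmin : ∀ j, 0 < j → j < k → (P ^ j) a ≠ b := fun j h0 hj h2 => Nat.find_min hex hj ⟨h0, h2⟩
  have ha : ∀ i, 0 < i → i ≤ k → (P ^ i) a ≠ a := by
    intro i h0 hi h2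
    rcases hi.eq_or_lt with rfl | hi
    · exact hab (h2.symm.trans hkb)
    · apply hmin (k - i) (by omega) (by omega)
      rw [← hkb, ← hk]
      conv_rhs => rw [show k = (k - i) + i by omega, pow_add, Equiv.Perm.mul_apply, h2]
  let I : Set X := {x | ∃ i, 0 < i ∧ i ≤ k ∧ (P ^ i) a = x}
  have hI : ∀ x ∈ I, Q x ∈ I := by
    rintro x ⟨i, h0, hi, rfl⟩
    rcases hi.eq_or_lt with rfl | hi
    · refine ⟨1, by omega, hk0, ?_⟩
      rw [hkb]; simp [hQ]
    · refine ⟨i+1, by omega, by omega, ?_⟩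
      rw [hQ, Equiv.Perm.mul_apply, Equiv.swap_apply_of_ne_of_ne (ha i h0 hi.le) (hmin i h0 hi),
        pow_succ' P]; rfl
  have hb : b ∈ I := ⟨k, hk0, le_rfl, hkb⟩
  have haI : a ∉ I := by rintro ⟨i, h0, hi, h2⟩; exact ha i h0 hi h2
  have hc2 := hc.symm
  rw [mk_eq] at hc2
  obtain ⟨i, -, h2⟩ := hc2.exists_pow_eq'
  apply haI
  rw [← h2]
  have : ∀ j : ℕ, (Q ^ j) b ∈ I := by
    intro j
    induction j with
    | zero => simpa using hb
    | succ j ih => rw [pow_succ', Equiv.Perm.mul_apply]; exact hI _ ih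
  exact this i

/-- Merging two cycles. -/
lemma merge_iff {X : Type*} [Finite X] [DecidableEq X] (P : Equiv.Perm X) {a b : X}
    (h : mk P a ≠ mk P b) (x y : X) :
    mk (P * Equiv.swap a b) x = mk (P * Equiv.swap a b) y ↔
      (if mk P x = mk P b then mk P a else mk P x) = (if mk P y = mk P b then mk P a else mk P y) := by
  set Q := P * Equiv.swap a b with hQ
  have hs : mk Q a = mk Q b := same_after P h
  constructor
  · intro hxy
    refine const_of_inv Q (fun x => if mk P x = mk P b then mk P a else mk P x) ?_ hxy
    intro x
    by_cases hxa : x = a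
    · subst hxa
      have : Q x = P b := by simp [hQ]
      simp [this, mk_apply, h]
    by_cases hxb : x = b
    · subst hxb
      have : Q x = P a := by simp [hQ]
      simp [this, mk_apply, h]
    have : Q x = P x := by
      rw [hQ, Equiv.Perm.mul_apply, Equiv.swap_apply_of_ne_of_ne hxa hxb]
    simp [this, mk_apply]
  · have hPQ : ∀ x y, mk P x = mk P y → mk Q x = mk Q y := by
      intro x y hxy
      refine const_of_inv P (mk Q) ?_ hxy
      intro x
      by_cases hxa : x = a
      · subst hxa
        have : P x = Q b := by simp [hQ]
        rw [this, mk_apply, hs]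
      by_cases hxb : x = b
      · subst hxb
        have : P x = Q a := by simp [hQ]
        rw [this, mk_apply, hs]
      have : Q x = P x := by
        rw [hQ, Equiv.Perm.mul_apply, Equiv.swap_apply_of_ne_of_ne hxa hxb]
      rw [← this, mk_apply]
    intro hxy
    split_ifs at hxy with h1 h2 h2
    · exact hPQ _ _ (h1.trans h2.symm)
    · rw [hPQ _ _ h1, ← hs]; exact hPQ _ _ hxy
    · rw [hPQ _ _ h2, ← hs]; exact hPQ _ _ hxy
    · exact hPQ _ _ hxy

lemma cyc_merge {X : Type*} [Finite X] [DecidableEq X] (P : Equiv.Perm X) {a b : X}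
    (h : mk P a ≠ mk P b) : cyc P = cyc (P * Equiv.swap a b) + 1 := by
  set Q := P * Equiv.swap a b with hQ
  have hf : ∀ x y, mk P x = mk P y → mk Q x = mk Q y := by
    intro x y hxy
    rw [hQ, merge_iff P h, hxy]
  let F : {q : Quotient (Equiv.Perm.SameCycle.setoid P) // q ≠ mk P b} →
      Quotient (Equiv.Perm.SameCycle.setoid Q) := fun q =>
    Quotient.lift (mk Q) (fun x y hxy => hf x y ((mk_eq P x y).2 hxy)) q.1
  have hF : ∀ x hx, F ⟨mk P x, hx⟩ = mk Q x := fun x hx => rfl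
  have hbij : Function.Bijective F := by
    constructor
    · rintro ⟨q, hq⟩ ⟨q', hq'⟩ hqq
      obtain ⟨x, rfl⟩ := mk_surj P q
      obtain ⟨y, rfl⟩ := mk_surj P q'
      rw [hF, hF, hQ, merge_iff P h, if_neg hq, if_neg hq'] at hqq
      simp [hqq]
    · intro q
      obtain ⟨x, rfl⟩ := mk_surj Q q
      by_cases hx : mk P x = mk P b
      · refine ⟨⟨mk P a, h⟩, ?_⟩
        rw [hF, hf _ _ hx]; exact same_after P h
      · exact ⟨⟨mk P x, hx⟩, hF _ _⟩
  unfold cyc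
  rw [← Nat.card_eq_of_bijective F hbij]
  have := Set.ncard_add_ncard_compl ({mk P b} : Set (Quotient (Equiv.Perm.SameCycle.setoid P)))
  rw [Set.ncard_singleton] at this
  rw [← this, add_comm]
  rfl

lemma cyc_split {X : Type*} [Finite X] [DecidableEq X] (P : Equiv.Perm X) {a b : X} (hab : a ≠ b)
    (h : mk P a = mk P b) : cyc (P * Equiv.swap a b) = cyc P + 1 := by
  have := cyc_merge (P * Equiv.swap a b) (diff_after P hab h)
  rwa [mul_assoc, Equiv.swap_mul_self, mul_one] at this

lemma cyc_pos {X : Type*} [Finite X] [Nonempty X] (P : Equiv.Perm X) : 0 < cyc P := by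
  have : Nonempty (Quotient (Equiv.Perm.SameCycle.setoid P)) := ⟨mk P (Classical.arbitrary X)⟩
  exact Nat.card_pos

section
variable {n : ℕ} {α : Equiv.Perm (ZMod (2 * n))}

noncomputable def aFun (α : Equiv.Perm (ZMod (2 * n))) (S : Set (ZMod (2 * n))) (x : ZMod (2 * n)) :
    ZMod (2 * n) := if x ∈ S then α x else x

lemma aFun_invol (hinv : ∀ x, α (α x) = x) {S : Set (ZMod (2 * n))} (hS : ∀ x ∈ S, α x ∈ S) :
    Function.Involutive (aFun α S) := by
  intro x
  unfold aFun
  by_cases h : x ∈ S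
  · simp [h, hS x h, hinv]
  · simp [h]

noncomputable def PS (hinv : ∀ x, α (α x) = x) {S : Set (ZMod (2 * n))} (hS : ∀ x ∈ S, α x ∈ S) :
    Equiv.Perm (ZMod (2 * n)) :=
  ((aFun_invol hinv hS).toPerm _).trans (Equiv.addRight 1)

lemma PS_mem (hinv : ∀ x, α (α x) = x) {S : Set (ZMod (2 * n))} (hS : ∀ x ∈ S, α x ∈ S)
    {x : ZMod (2 * n)} (hx : x ∈ S) : PS hinv hS x = α x + 1 := by
  show aFun α S x + 1 = _
  simp [aFun, hx]

lemma PS_not_mem (hinv : ∀ x, α (α x) = x) {S : Set (ZMod (2 * n))} (hS : ∀ x ∈ S, α x ∈ S)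
    {x : ZMod (2 * n)} (hx : x ∉ S) : PS hinv hS x = x + 1 := by
  show aFun α S x + 1 = _
  simp [aFun, hx]

lemma inv_diff (hinv : ∀ x, α (α x) = x) {S : Set (ZMod (2 * n))} (hS : ∀ x ∈ S, α x ∈ S)
    (v : ZMod (2 * n)) : ∀ x ∈ S \ {v, α v}, α x ∈ S \ {v, α v} := by
  rintro x ⟨hx, hxv⟩
  refine ⟨hS x hx, ?_⟩
  simp only [Set.mem_insert_iff, Set.mem_singleton_iff, not_or] at hxv ⊢
  refine ⟨?_, ?_⟩
  · rintro rfl; exact hxv.2 (hinv x).symm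
  · intro h; exact hxv.1 (α.injective h)

lemma PS_diff (hinv : ∀ x, α (α x) = x) {S T : Set (ZMod (2 * n))}
    (hS : ∀ x ∈ S, α x ∈ S) (hT : ∀ x ∈ T, α x ∈ T)
    {v : ZMod (2 * n)} (hv : v ∈ S) (hST : T = S \ {v, α v}) :
    PS hinv hT = PS hinv hS * Equiv.swap v (α v) := by
  ext1 x
  rw [Equiv.Perm.mul_apply]
  by_cases h1 : x = v
  · subst h1
    rw [Equiv.swap_apply_left, PS_mem hinv hS (hS _ hv), PS_not_mem, hinv]
    simp [hST]
  by_cases h2 : x = α v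
  · subst h2
    rw [Equiv.swap_apply_right, PS_mem hinv hS hv, PS_not_mem]
    simp [hST]
  rw [Equiv.swap_apply_of_ne_of_ne h1 h2]
  by_cases hx : x ∈ S
  · rw [PS_mem hinv hS hx, PS_mem]
    simp [hST, hx, h1, h2]
  · rw [PS_not_mem hinv hS hx, PS_not_mem]
    simp [hST, hx]

lemma firstAfter_of_mem (S : Set (ZMod (2 * n))) {y : ZMod (2 * n)} (h : y + 1 ∈ S) :
    firstAfter n S y = y + 1 := by
  have hex : ∃ k : ℕ, 0 < k ∧ y + (k : ZMod (2 * n)) ∈ S := ⟨1, by simpa using h⟩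
  have : Nat.find hex = 1 := by
    rw [Nat.find_eq_iff]
    refine ⟨⟨by norm_num, by simpa using h⟩, ?_⟩
    intro m hm h2; omega
  unfold firstAfter
  rw [dif_pos hex, this]; simp

lemma exists_after [NeZero (2 * n)] {S : Set (ZMod (2 * n))} (hS : S.Nonempty) (y : ZMod (2 * n)) :
    ∃ k : ℕ, 0 < k ∧ y + (k : ZMod (2 * n)) ∈ S := by
  obtain ⟨s, hs⟩ := hS
  refine ⟨(s - y).val + 2 * n, ?_, ?_⟩
  · have := NeZero.pos (2 * n); omega
  · rw [Nat.cast_add, ZMod.natCast_self, ZMod.natCast_zmod_val]; simpa using hs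

lemma firstAfter_mem [NeZero (2 * n)] {S : Set (ZMod (2 * n))} (hS : S.Nonempty)
    (y : ZMod (2 * n)) : firstAfter n S y ∈ S := by
  unfold firstAfter
  rw [dif_pos (exists_after hS y)]
  exact (Nat.find_spec (exists_after hS y)).2

lemma firstAfter_of_not_mem [NeZero (2 * n)] {S : Set (ZMod (2 * n))} (hS : S.Nonempty)
    {y : ZMod (2 * n)} (h : y + 1 ∉ S) :
    firstAfter n S y = firstAfter n S (y + 1) := by
  have h1 := exists_after hS y
  have h2 := exists_after hS (y + 1)
  have : Nat.find h1 = Nat.find h2 + 1 := by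
    rw [Nat.find_eq_iff]
    obtain ⟨h3, h4⟩ := Nat.find_spec h2
    refine ⟨⟨by omega, ?_⟩, ?_⟩
    · convert h4 using 1; push_cast; ring
    · rintro m hm ⟨h5, h6⟩
      rcases Nat.lt_or_ge 1 m with h7 | h7
      · apply Nat.find_min h2 (m := m - 1) (by omega)
        refine ⟨by omega, ?_⟩
        rw [Nat.cast_sub h5]
        convert h6 using 1; push_cast; ring
      · have : m = 1 := by omega
        subst this; apply h; simpa using h6
  unfold firstAfter
  rw [dif_pos h1, dif_pos h2, this]; push_cast; ring

/-- The class of the first point at or after `z` is invariant. -/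
lemma mk_firstAfter [NeZero (2 * n)] (hinv : ∀ x, α (α x) = x) {S : Set (ZMod (2 * n))}
    (hS : ∀ x ∈ S, α x ∈ S) (hne : S.Nonempty) (z : ZMod (2 * n)) :
    mk (PS hinv hS) (firstAfter n S z) = mk (PS hinv hS) (z + 1) := by
  obtain ⟨k, hk⟩ : ∃ k, k = Nat.find (exists_after hne z) := ⟨_, rfl⟩
  induction k using Nat.strong_induction_on generalizing z with
  | _ k ih =>
  by_cases h : z + 1 ∈ S
  · rw [firstAfter_of_mem S h]
  · rw [firstAfter_of_not_mem hne h]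
    rw [ih _ ?_ (z + 1) rfl]
    · rw [← mk_apply _ (z + 1), PS_not_mem hinv hS h]
    · rw [hk]
      have h1 := exists_after hne z
      obtain ⟨h3, h4⟩ := Nat.find_spec h1
      have h5 : Nat.find h1 ≠ 1 := by
        intro h5; rw [h5] at h4; apply h; simpa using h4
      refine lt_of_le_of_lt (Nat.find_min' (m := Nat.find h1 - 1) _ ⟨by omega, ?_⟩) (by omega)
      rw [Nat.cast_sub h3]; convert h4 using 1; push_cast; ring

lemma orbitCount_eq [NeZero (2 * n)] (hinv : ∀ x, α (α x) = x) {S : Set (ZMod (2 * n))}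
    (hS : ∀ x ∈ S, α x ∈ S) : orbitCount n α S = cyc (PS hinv hS) := by
  by_cases hne : S = ∅
  · subst hne
    unfold orbitCount cyc
    rw [if_pos rfl]
    symm
    rw [Nat.card_eq_one_iff_unique]
    refine ⟨⟨?_⟩, ⟨mk _ 0⟩⟩
    have : ∀ k : ℕ, mk (PS hinv hS) (k : ZMod (2 * n)) = mk (PS hinv hS) 0 := by
      intro k
      induction k with
      | zero => simp
      | succ k ih =>
        rw [← ih, ← mk_apply _ (k : ZMod (2 * n)), PS_not_mem hinv hS (by simp)]; simp
    intro q r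
    obtain ⟨x, rfl⟩ := mk_surj _ q
    obtain ⟨y, rfl⟩ := mk_surj _ r
    rw [← ZMod.natCast_zmod_val x, ← ZMod.natCast_zmod_val y, this, this]
  · have hne' : S.Nonempty := Set.nonempty_iff_ne_empty.2 hne
    unfold orbitCount
    rw [if_neg hne]
    set P := PS hinv hS with hP
    set R := boundaryStep n α S with hR
    have cl : ∀ x y, Relation.EqvGen R x y →
        {z | Relation.EqvGen R x z} = {z | Relation.EqvGen R y z} := by
      intro x y h
      ext z
      exact ⟨fun h2 => (h.symm).trans _ _ _ h2, fun h2 => h.trans _ _ _ h2⟩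
    have f1 : ∀ x y, Relation.EqvGen R x y → mk P x = mk P y := by
      intro x y h
      induction h with
      | rel x y h =>
        obtain ⟨hx, rfl⟩ := h
        rw [hP, mk_firstAfter hinv hS hne', ← mk_apply _ x, PS_mem hinv hS hx]
      | refl x => rfl
      | symm x y _ ih => exact ih.symm
      | trans x y z _ _ ih1 ih2 => exact ih1.trans ih2
    let r : ZMod (2 * n) → ZMod (2 * n) := fun z => firstAfter n S (z - 1)
    have hr : ∀ x ∈ S, r x = x := by
      intro x hx
      show firstAfter n S (x - 1) = x
      rw [firstAfter_of_mem] <;> simp [hx]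
    have hrm : ∀ x, r x ∈ S := fun x => firstAfter_mem hne' _
    have hrP : ∀ x, mk P (r x) = mk P x := by
      intro x
      have := mk_firstAfter hinv hS hne' (x - 1)
      rwa [sub_add_cancel] at this
    let h : ZMod (2 * n) → Set (ZMod (2 * n)) := fun x => {y | Relation.EqvGen R (r x) y}
    have hh : ∀ x, h (P x) = h x := by
      intro x
      by_cases hx : x ∈ S
      · symm
        apply cl
        rw [hr x hx]
        apply Relation.EqvGen.rel
        refine ⟨hx, ?_⟩
        show firstAfter n S (P x - 1) = _
        rw [hP, PS_mem hinv hS hx]; simp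
      · have : r (P x) = r x := by
          show firstAfter n S (P x - 1) = firstAfter n S (x - 1)
          rw [hP, PS_not_mem hinv hS hx, firstAfter_of_not_mem hne' (y := x - 1) (by simpa using hx)]
          simp
        show {y | _} = {y | _}
        rw [this]
    let H : Quotient (Equiv.Perm.SameCycle.setoid P) → Set (ZMod (2 * n)) :=
      Quotient.lift h (fun x y hxy => const_of_inv P h hh ((mk_eq P x y).2 hxy))
    have hH : ∀ x, H (mk P x) = h x := fun x => rfl
    have hinj : Function.Injective H := by
      intro q q' hq
      obtain ⟨x, rfl⟩ := mk_surj _ q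
      obtain ⟨y, rfl⟩ := mk_surj _ q'
      rw [hH, hH] at hq
      have : r y ∈ h x := by rw [hq]; exact Relation.EqvGen.refl _
      rw [← hrP x, ← hrP y]
      exact f1 _ _ this
    have hrange : (fun x => {y | Relation.EqvGen R x y}) '' S = Set.range H := by
      ext s
      constructor
      · rintro ⟨x, hx, rfl⟩
        refine ⟨mk P x, ?_⟩
        rw [hH]
        show {y | Relation.EqvGen R (r x) y} = _
        rw [hr x hx]
      · rintro ⟨q, rfl⟩
        obtain ⟨x, rfl⟩ := mk_surj _ q
        exact ⟨r x, hrm x, rfl⟩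
    rw [hrange]
    exact Nat.card_range_of_injective hinj

end

section
variable {n : ℕ} {α : Equiv.Perm (ZMod (2 * n))} [NeZero (2 * n)]

lemma step_eq (hinv : ∀ x, α (α x) = x) (hfree : ∀ x, α x ≠ x) {S : Set (ZMod (2 * n))}
    (hS : ∀ x ∈ S, α x ∈ S) {v : ZMod (2 * n)} (hv : v ∈ S)
    (h : mk (PS hinv hS) v = mk (PS hinv hS) (α v)) :
    orbitCount n α (S \ {v, α v}) = orbitCount n α S + 1 := by
  rw [orbitCount_eq hinv hS, orbitCount_eq hinv (inv_diff hinv hS v),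
    PS_diff hinv hS (inv_diff hinv hS v) hv rfl]
  exact cyc_split _ (hfree v).symm h

lemma step_ne (hinv : ∀ x, α (α x) = x) {S : Set (ZMod (2 * n))}
    (hS : ∀ x ∈ S, α x ∈ S) {v : ZMod (2 * n)} (hv : v ∈ S)
    (h : mk (PS hinv hS) v ≠ mk (PS hinv hS) (α v)) :
    orbitCount n α S = orbitCount n α (S \ {v, α v}) + 1 := by
  rw [orbitCount_eq hinv hS, orbitCount_eq hinv (inv_diff hinv hS v),
    PS_diff hinv hS (inv_diff hinv hS v) hv rfl]
  exact cyc_merge _ h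

lemma orbitCount_pos (hinv : ∀ x, α (α x) = x) {S : Set (ZMod (2 * n))}
    (hS : ∀ x ∈ S, α x ∈ S) : 0 < orbitCount n α S := by
  rw [orbitCount_eq hinv hS]; exact cyc_pos _

lemma inv_pair (hinv : ∀ x, α (α x) = x) (v : ZMod (2 * n)) :
    ∀ x ∈ ({v, α v} : Set (ZMod (2 * n))), α x ∈ ({v, α v} : Set (ZMod (2 * n))) := by
  rintro x (rfl | rfl)
  · simp
  · simp [hinv]

lemma pair_ne (hinv : ∀ x, α (α x) = x) (hfree : ∀ x, α x ≠ x) (v : ZMod (2 * n)) :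
    mk (PS hinv (inv_pair hinv v)) v ≠ mk (PS hinv (inv_pair hinv v)) (α v) := by
  intro h
  have h1 := step_eq hinv hfree (inv_pair hinv v) (by simp) h
  have h2 := orbitCount_pos hinv (inv_pair hinv v)
  rw [Set.sdiff_self] at h1
  have h3 : orbitCount n α ∅ = 1 := by simp [orbitCount]
  omega

lemma pair_count (hinv : ∀ x, α (α x) = x) (hfree : ∀ x, α x ≠ x) (v : ZMod (2 * n)) :
    orbitCount n α {v, α v} = 2 := by
  have h1 := step_ne hinv (inv_pair hinv v) (by simp) (pair_ne hinv hfree v)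
  rw [Set.sdiff_self] at h1
  have h3 : orbitCount n α ∅ = 1 := by simp [orbitCount]
  omega

lemma val_shift (v : ZMod (2 * n)) {k : ℕ} (hk : k < 2 * n) :
    (v + (k : ZMod (2 * n)) - v).val = k := by
  rw [add_sub_cancel_left, ZMod.val_natCast_of_lt hk]

lemma pair_mk (hinv : ∀ x, α (α x) = x) (v z : ZMod (2 * n)) :
    mk (PS hinv (inv_pair hinv v)) z =
      if 0 < (z - v).val ∧ (z - v).val ≤ (α v - v).val then
        mk (PS hinv (inv_pair hinv v)) (α v) else mk (PS hinv (inv_pair hinv v)) v := by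
  set P := PS hinv (inv_pair hinv v) with hP
  set m := (α v - v).val with hm
  have hm2 : m < 2 * n := ZMod.val_lt _
  have hav : α v = v + (m : ZMod (2 * n)) := by
    rw [hm, ZMod.natCast_zmod_val]; ring
  have hnot : ∀ k : ℕ, 0 < k → k ≠ m → k < 2 * n →
      mk P (v + ((k + 1 : ℕ) : ZMod (2 * n))) = mk P (v + (k : ZMod (2 * n))) := by
    intro k h0 h1 h2
    rw [← mk_apply P (v + (k : ZMod (2 * n))), hP, PS_not_mem]
    · push_cast; rw [add_assoc]
    · rintro (h3 | h3)
      · have := val_shift v h2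
        rw [h3] at this; simp at this; omega
      · have := val_shift v h2
        rw [Set.mem_singleton_iff] at h3
        rw [h3] at this; omega
  have hz : z = v + ((z - v).val : ZMod (2 * n)) := by
    rw [ZMod.natCast_zmod_val]; ring
  have hz2 : (z - v).val < 2 * n := ZMod.val_lt _
  have A : ∀ k : ℕ, 1 ≤ k → k ≤ m → mk P (v + (k : ZMod (2 * n))) = mk P (α v) := by
    intro k hk
    induction k, hk using Nat.le_induction with
    | base =>
      intro _
      rw [← mk_apply P (α v), hP, PS_mem _ _ (by simp), hinv]; simp
    | succ k hk ih =>
      intro h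
      rw [hnot k hk (by omega) (by omega), ih (by omega)]
  have B : ∀ k : ℕ, m + 1 ≤ k → k < 2 * n → mk P (v + (k : ZMod (2 * n))) = mk P v := by
    intro k hk
    induction k, hk using Nat.le_induction with
    | base =>
      intro _
      rw [← mk_apply P v, hP, PS_mem _ _ (by simp)]
      congr 1; rw [hav]; push_cast; rw [add_assoc]
    | succ k hk ih =>
      intro h
      rw [hnot k (by omega) (by omega) (by omega), ih (by omega)]
  generalize (z - v).val = k at *
  subst hz
  split_ifs with h
  · exact A k h.1 h.2
  · by_cases h0 : k = 0
    · subst h0; simp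
    · exact B k (by omega) hz2

lemma inter_def (v u : ZMod (2 * n)) : Interlaces n α v u ↔
    (((0 < (u - v).val ∧ (u - v).val < (α v - v).val) ∧
      ¬ (0 < (α u - v).val ∧ (α u - v).val < (α v - v).val)) ∨
     ((0 < (α u - v).val ∧ (α u - v).val < (α v - v).val) ∧
      ¬ (0 < (u - v).val ∧ (u - v).val < (α v - v).val))) := Iff.rfl

lemma inter_iff (hinv : ∀ x, α (α x) = x) (hfree : ∀ x, α x ≠ x) {v u : ZMod (2 * n)}
    (h1 : u ≠ v) (h2 : u ≠ α v) :
    Interlaces n α v u ↔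
      mk (PS hinv (inv_pair hinv v)) u ≠ mk (PS hinv (inv_pair hinv v)) (α u) := by
  have hne := pair_ne hinv hfree v
  rw [pair_mk hinv v u, pair_mk hinv v (α u)]
  have e1 : (u - v).val ≠ (α v - v).val := by
    intro h; exact h2 (sub_left_injective (ZMod.val_injective _ h))
  have e2 : (α u - v).val ≠ (α v - v).val := by
    intro h; exact h1 (α.injective (sub_left_injective (ZMod.val_injective _ h)))
  have e3 : ((u - v).val ≤ (α v - v).val) ↔ ((u - v).val < (α v - v).val) := by omega
  have e4 : ((α u - v).val ≤ (α v - v).val) ↔ ((α u - v).val < (α v - v).val) := by omega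
  rw [inter_def]
  simp only [e3, e4]
  by_cases p : 0 < (u - v).val ∧ (u - v).val < (α v - v).val <;>
  by_cases q : 0 < (α u - v).val ∧ (α u - v).val < (α v - v).val <;>
  simp only [p, q, if_true, if_false, ne_eq] <;> simp <;>
  first | exact hne | exact hne.symm

lemma inter_ne {v u : ZMod (2 * n)} (hinv : ∀ x, α (α x) = x) (h : Interlaces n α v u) :
    u ≠ v ∧ u ≠ α v := by
  constructor
  · rintro rfl; simp [inter_def] at h
  · rintro rfl; simp [inter_def, hinv] at h

/-- The four endpoints of two chords. -/
def quad (α : Equiv.Perm (ZMod (2 * n))) (v u : ZMod (2 * n)) : Set (ZMod (2 * n)) :=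
  {v, α v} ∪ {u, α u}

lemma inv_quad (hinv : ∀ x, α (α x) = x) (v u : ZMod (2 * n)) :
    ∀ x ∈ quad α v u, α x ∈ quad α v u := by
  rintro x (h | h)
  · exact Or.inl (inv_pair hinv v x h)
  · exact Or.inr (inv_pair hinv u x h)

lemma quad_diff (hinv : ∀ x, α (α x) = x) {v u : ZMod (2 * n)} (h1 : u ≠ v) (h2 : u ≠ α v) :
    ({v, α v} : Set (ZMod (2 * n))) = quad α v u \ {u, α u} := by
  unfold quad
  rw [Set.union_sdiff_right]
  symm
  rw [sdiff_eq_left, Set.disjoint_left]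
  have h3 : α u ≠ v := by intro h; apply h2; rw [← h, hinv]
  have h4 : α u ≠ α v := fun h => h1 (α.injective h)
  rintro x (rfl | rfl) (h | h)
  · exact h1 h.symm
  · exact h3 h.symm
  · exact h2 h.symm
  · exact h4 h.symm

lemma quad_inter (hinv : ∀ x, α (α x) = x) (hfree : ∀ x, α x ≠ x) {v u : ZMod (2 * n)}
    (h1 : u ≠ v) (h2 : u ≠ α v) :
    (Interlaces n α v u → orbitCount n α (quad α v u) = 1) ∧
    (¬ Interlaces n α v u → orbitCount n α (quad α v u) = 3) := by
  have hP := PS_diff hinv (inv_quad hinv v u) (inv_pair hinv v) (v := u) (Or.inr (by simp))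
    (quad_diff hinv h1 h2)
  have hQ : PS hinv (inv_quad hinv v u) = PS hinv (inv_pair hinv v) * Equiv.swap u (α u) := by
    rw [hP, mul_assoc, Equiv.swap_mul_self, mul_one]
  have h3 := pair_count hinv hfree v
  rw [inter_iff hinv hfree h1 h2]
  rw [orbitCount_eq hinv (inv_pair hinv v)] at h3
  rw [orbitCount_eq hinv (inv_quad hinv v u), hQ]
  constructor
  · intro h
    have := cyc_merge _ h
    omega
  · intro h
    have := cyc_split _ (hfree u).symm (not_not.1 h)
    omega

lemma quad_bound (hinv : ∀ x, α (α x) = x) (hfree : ∀ x, α x ≠ x) {v u : ZMod (2 * n)}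
    (hvu : Interlaces n α v u) (S : Set (ZMod (2 * n))) (hS : ∀ x ∈ S, α x ∈ S)
    (hq : quad α v u ⊆ S) : 2 * orbitCount n α S + 2 ≤ S.ncard := by
  obtain ⟨h1, h2⟩ := inter_ne hinv hvu
  obtain ⟨k, hk⟩ : ∃ k, k = S.ncard := ⟨_, rfl⟩
  induction k using Nat.strong_induction_on generalizing S with
  | _ k ih =>
  by_cases hSq : S = quad α v u
  · subst hSq
    rw [(quad_inter hinv hfree h1 h2).1 hvu]
    have hd := Set.ncard_sdiff_add_ncard_of_subset (s := {u, α u}) (t := quad α v u)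
      (Set.subset_union_right) (Set.toFinite _)
    rw [← quad_diff hinv h1 h2, Set.ncard_pair (hfree u).symm, Set.ncard_pair (hfree v).symm] at hd
    omega
  · obtain ⟨x, hxS, hxq⟩ : ∃ x ∈ S, x ∉ quad α v u := by
      by_contra! hc
      exact hSq (Set.Subset.antisymm hc hq)
    have hxS' : ({x, α x} : Set (ZMod (2 * n))) ⊆ S := by
      rintro y (rfl | rfl)
      · exact hxS
      · exact hS _ hxS
    have hd := Set.ncard_sdiff_add_ncard_of_subset hxS' (Set.toFinite _)
    rw [Set.ncard_pair (hfree x).symm] at hd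
    have hqT : quad α v u ⊆ S \ {x, α x} := by
      intro y hy
      refine ⟨hq hy, ?_⟩
      rintro (rfl | rfl)
      · exact hxq hy
      · have := inv_quad hinv v u _ hy
        rw [hinv] at this; exact hxq this
    have := ih _ (by omega) (S \ {x, α x}) (inv_diff hinv hS x) hqT rfl
    by_cases hm : mk (PS hinv hS) x = mk (PS hinv hS) (α x)
    · have := step_eq hinv hfree hS hxS hm; omega
    · have := step_ne hinv hS hxS hm; omega

lemma inv_univ : ∀ x ∈ (Set.univ : Set (ZMod (2 * n))), α x ∈ (Set.univ : Set (ZMod (2 * n))) :=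
  fun _ _ => trivial

/-- pairwise interlacing forces antipodality -/
lemma antipodal (hinv : ∀ x, α (α x) = x) (hfree : ∀ x, α x ≠ x)
    (hall : ∀ v u : ZMod (2 * n), u ≠ v → u ≠ α v → Interlaces n α v u) (x : ZMod (2 * n)) :
    α x = x + (n : ZMod (2 * n)) := by
  set m := (α x - x).val with hm
  have hm2 : m < 2 * n := ZMod.val_lt _
  have hav : α x = x + (m : ZMod (2 * n)) := by
    rw [hm, ZMod.natCast_zmod_val]; ring
  have hm0 : 0 < m := by
    rw [Nat.pos_iff_ne_zero]
    intro h; rw [h] at hav; simp at hav; exact hfree x hav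
  let φ : ℕ → ℕ := fun k => (α (x + (k : ZMod (2 * n))) - x).val
  have hφ : ∀ k, k < 2 * n → ∀ l, l < 2 * n → φ k = φ l → k = l := by
    intro k hk l hl h
    have h3 := α.injective (sub_left_injective (ZMod.val_injective _ h))
    rw [← val_shift x hk, ← val_shift x hl, h3]
  have key : ∀ k, 0 < k → k < 2 * n → k ≠ m →
      φ k < 2 * n ∧ φ k ≠ m ∧ 0 < φ k ∧ (k < m ↔ ¬ φ k < m) := by
    intro k h0 hk hkm
    have hv := val_shift x hk
    have h1 : x + (k : ZMod (2 * n)) ≠ x := by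
      intro h; rw [h] at hv; simp at hv; omega
    have h2 : x + (k : ZMod (2 * n)) ≠ α x := by
      intro h; rw [h] at hv; omega
    have hI := hall x _ h1 h2
    rw [inter_def, hv, ← hm] at hI
    have hp : 0 < φ k := by
      rw [Nat.pos_iff_ne_zero]
      intro h
      have := (ZMod.val_eq_zero _).1 h
      rw [sub_eq_zero] at this
      apply h2; rw [← this, hinv]; rw [this]
    refine ⟨ZMod.val_lt _, ?_, hp, ?_⟩
    · intro h
      exact h1 (α.injective (sub_left_injective (ZMod.val_injective _ h)))
    · change ((0 < k ∧ k < m) ∧ ¬ (0 < φ k ∧ φ k < m)) ∨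
        ((0 < φ k ∧ φ k < m) ∧ ¬ (0 < k ∧ k < m)) at hI
      tauto
  have c1 : (Finset.Ioo 0 m).card ≤ (Finset.Ioo m (2 * n)).card := by
    apply Finset.card_le_card_of_injOn φ
    · intro k hk
      simp only [Finset.coe_Ioo, Set.mem_Ioo] at hk ⊢
      have := key k hk.1 (by omega) (by omega)
      omega
    · intro k hk l hl h
      simp only [Finset.coe_Ioo, Set.mem_Ioo] at hk hl
      exact hφ k (by omega) l (by omega) h
  have c2 : (Finset.Ioo m (2 * n)).card ≤ (Finset.Ioo 0 m).card := by
    apply Finset.card_le_card_of_injOn φ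
    · intro k hk
      simp only [Finset.coe_Ioo, Set.mem_Ioo] at hk ⊢
      have := key k (by omega) (by omega) (by omega)
      omega
    · intro k hk l hl h
      simp only [Finset.coe_Ioo, Set.mem_Ioo] at hk hl
      exact hφ k (by omega) l (by omega) h
  simp only [Nat.card_Ioo] at c1 c2
  have : m = n := by omega
  rw [hav, this]

lemma main_aux (hn : 2 ≤ n) (hinv : ∀ x, α (α x) = x) (hfree : ∀ x, α x ≠ x)
    (hconn : (interGraph n α).Connected)
    (hgenus : ∀ S : Set (ZMod (2 * n)), (∀ x ∈ S, α x ∈ S) →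
      pdGenus n α S = pdGenus n α ∅) :
    Odd n ∧ ∀ x : ZMod (2 * n), α x = x + (n : ZMod (2 * n)) := by
  set P := PS hinv (S := Set.univ) inv_univ with hP
  set f := orbitCount n α Set.univ with hf
  have h0 : orbitCount n α ∅ = 1 := by simp [orbitCount]
  have hg0 : pdGenus n α ∅ = (2 + n - 1 - f) / 2 := by
    unfold pdGenus; rw [h0, Set.compl_empty]
  -- an interlacing pair
  obtain ⟨v0, u0, hvu⟩ : ∃ v u, Interlaces n α v u := by
    by_contra! hc
    have hsub : ∀ c d, (interGraph n α).Reachable c d → c = d := by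
      intro c d h
      obtain ⟨w⟩ := h
      cases w with
      | nil => rfl
      | cons h _ =>
        exfalso
        rw [interGraph, SimpleGraph.fromRel_adj] at h
        rcases h.2 with ⟨x, y, -, -, h⟩ | ⟨x, y, -, -, h⟩ <;> exact hc _ _ h
    have hx : ∀ x : ZMod (2 * n), x = 0 ∨ x = α 0 := by
      intro x
      have := hsub ⟨s(x, α x), x, rfl⟩ ⟨s(0, α 0), 0, rfl⟩ (hconn.preconnected _ _)
      simp only [Subtype.mk.injEq, Sym2.eq_iff] at this
      tauto
    have : (Set.univ : Set (ZMod (2 * n))) ⊆ {0, α 0} := fun x _ => hx x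
    have h2 := Set.ncard_le_ncard this (Set.toFinite _)
    rw [Set.ncard_univ, Nat.card_zmod, Set.ncard_pair (hfree 0).symm] at h2
    omega
  have hfn : f + 1 ≤ n := by
    have := quad_bound hinv hfree hvu Set.univ inv_univ (Set.subset_univ _)
    rw [Set.ncard_univ, Nat.card_zmod] at this
    omega
  -- every chord separates two faces
  have hsep : ∀ x, mk P x ≠ mk P (α x) := by
    intro x h
    have h1 := step_eq hinv hfree inv_univ (Set.mem_univ x) h
    have h2 := hgenus _ (inv_pair hinv x)
    rw [hg0] at h2
    unfold pdGenus at h2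
    rw [pair_count hinv hfree, Set.compl_eq_univ_sdiff, h1] at h2
    omega
  have hdel : ∀ x, f = orbitCount n α (Set.univ \ {x, α x}) + 1 :=
    fun x => step_ne hinv inv_univ (Set.mem_univ x) (hsep x)
  have hquadc : ∀ v u, (quad α v u)ᶜ = (Set.univ \ {v, α v}) \ {u, α u} := by
    intro v u
    rw [quad, Set.compl_eq_univ_sdiff, Set.sdiff_sdiff]
  have hadj : ∀ v u, Interlaces n α v u → s(mk P v, mk P (α v)) = s(mk P u, mk P (α u)) := by
    intro v u h
    obtain ⟨h1, h2⟩ := inter_ne hinv h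
    have h3 := (quad_inter hinv hfree h1 h2).1 h
    have hg := hgenus _ (inv_quad hinv v u)
    rw [hg0] at hg
    unfold pdGenus at hg
    rw [h3, hquadc] at hg
    have huT : u ∈ (Set.univ \ {v, α v} : Set (ZMod (2 * n))) := by simp [h1, h2]
    have hd := hdel v
    have hm : mk (PS hinv (inv_diff hinv inv_univ v)) u =
        mk (PS hinv (inv_diff hinv inv_univ v)) (α u) := by
      by_contra hc
      have := step_ne hinv (inv_diff hinv inv_univ v) huT hc
      omega
    rw [PS_diff hinv inv_univ (inv_diff hinv inv_univ v) (Set.mem_univ v) rfl,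
      merge_iff _ (hsep v)] at hm
    have := hsep u
    rw [Sym2.eq_iff]
    split_ifs at hm with p q q
    · exact absurd (p.trans q.symm) this
    · exact Or.inr ⟨hm, p.symm⟩
    · exact Or.inl ⟨hm.symm, q.symm⟩
    · exact absurd hm this
  have hall : ∀ x y, s(mk P x, mk P (α x)) = s(mk P y, mk P (α y)) := by
    have key : ∀ c d, (interGraph n α).Reachable c d → c.1.map (mk P) = d.1.map (mk P) := by
      rintro c d ⟨w⟩
      induction w with
      | nil => rfl
      | cons h _ ih =>
        rw [← ih]
        rw [interGraph, SimpleGraph.fromRel_adj] at h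
        rcases h.2 with ⟨x, y, h1, h2, h⟩ | ⟨x, y, h1, h2, h⟩
        · rw [h1, h2]; exact hadj _ _ h
        · rw [h1, h2]; exact (hadj _ _ h).symm
    intro x y
    exact key ⟨s(x, α x), x, rfl⟩ ⟨s(y, α y), y, rfl⟩ (hconn.preconnected _ _)
  have htwo : ∀ x y, mk P x = mk P y ∨ mk P x = mk P (α y) := by
    intro x y
    have := hall x y
    rw [Sym2.eq_iff] at this
    tauto
  have hf2 : f ≤ 2 := by
    rw [hf, orbitCount_eq hinv inv_univ]
    unfold cyc
    rw [← Set.ncard_univ]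
    refine le_trans (Set.ncard_le_ncard (t := {mk P 0, mk P (α 0)}) ?_ (Set.toFinite _))
      ((Set.ncard_insert_le _ _).trans (by rw [Set.ncard_singleton]))
    intro q _
    obtain ⟨x, rfl⟩ := mk_surj _ q
    exact htwo x 0
  have hint : ∀ v u : ZMod (2 * n), u ≠ v → u ≠ α v → Interlaces n α v u := by
    intro v u h1 h2
    by_contra h
    have h3 := (quad_inter hinv hfree h1 h2).2 h
    have hg := hgenus _ (inv_quad hinv v u)
    rw [hg0] at hg
    unfold pdGenus at hg
    rw [h3, hquadc] at hg
    have huT : u ∈ (Set.univ \ {v, α v} : Set (ZMod (2 * n))) := by simp [h1, h2]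
    have hd := hdel v
    have hpos := orbitCount_pos hinv (inv_diff hinv (inv_diff hinv (S := Set.univ) inv_univ v) u)
    by_cases hc : mk (PS hinv (inv_diff hinv inv_univ v)) u =
        mk (PS hinv (inv_diff hinv inv_univ v)) (α u)
    · have := step_eq hinv hfree (inv_diff hinv inv_univ v) huT hc
      omega
    · have := step_ne hinv (inv_diff hinv inv_univ v) huT hc
      omega
  have hanti := antipodal hinv hfree hint
  refine ⟨?_, hanti⟩
  by_contra hodd
  rw [Nat.not_odd_iff_even] at hodd
  obtain ⟨j, hj⟩ := hodd
  have hstep : ∀ y, mk P (y + 1) = mk P (α y) := by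
    intro y
    rw [← mk_apply P (α y), hP, PS_mem _ _ (Set.mem_univ _), hinv]
  have hstep2 : ∀ y, mk P (y + 2) = mk P y := by
    intro y
    rcases htwo (y + 2) y with h | h
    · exact h
    · exfalso
      rw [show y + 2 = (y + 1) + 1 by ring, hstep] at h
      rw [← hstep y] at h
      exact hsep _ h.symm
  have hk : ∀ k : ℕ, mk P ((2 * k : ℕ) : ZMod (2 * n)) = mk P 0 := by
    intro k
    induction k with
    | zero => simp
    | succ k ih => rw [← ih, ← hstep2 ((2 * k : ℕ) : ZMod (2 * n))]; push_cast; ring_nf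
  apply hsep 0
  rw [hanti 0, zero_add, show (n : ZMod (2 * n)) = ((2 * j : ℕ) : ZMod (2 * n)) by
    rw [← two_mul] at hj; rw [← hj], hk j]

end

end GMT

/-- **Gross–Mansour–Tucker conjecture, one-vertex form** (main theorem).
If `α` is a chord diagram of order `n ≥ 1` with connected interlacement graph
(i.e. the one-vertex ribbon graph of `α` is join-prime) and all partial duals of the
one-vertex ribbon graph of `α` have the same genus, then `n` is odd and `α = B_n`. -/
theorem gmt_one_vertex (n : ℕ) (hn : 1 ≤ n) (α : Equiv.Perm (ZMod (2 * n)))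
    (hinv : ∀ x, α (α x) = x) (hfree : ∀ x, α x ≠ x)
    (hconn : (interGraph n α).Connected)
    (hgenus : ∀ S : Set (ZMod (2 * n)), (∀ x ∈ S, α x ∈ S) →
      pdGenus n α S = pdGenus n α ∅) :
    Odd n ∧ ∀ x : ZMod (2 * n), α x = x + (n : ZMod (2 * n)) := by
  rcases Nat.lt_or_ge 1 n with h | h
  · have : NeZero (2 * n) := ⟨by omega⟩
    exact GMT.main_aux h hinv hfree hconn hgenus
  · have : n = 1 := by omega
    subst this
    refine ⟨odd_one, fun x => ?_⟩
    have key : ∀ a b : ZMod (2 * 1), a ≠ b → a = b + ((1 : ℕ) : ZMod (2 * 1)) := by decide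
    exact key _ _ (hfree x)
end

section
/- Let n ≥ 1 and let α be a chord diagram of order n whose interlacement graph is connected, and suppose g(α, A) = g(α, ∅) for every set A of chords of α. Then for every x ∈ ZMod (2n), the points x and α x lie in different orbits of the permutation ρ ∘ α; that is, every edge of the one-vertex ribbon graph of α is attached to two different face-discs (every edge is of Type up). -/
open scoped Classical

noncomputable def cyc {X : Type*} (σ : Equiv.Perm X) : ℕ :=
  Nat.card (Quotient (Equiv.Perm.SameCycle.setoid σ))

lemma mk_eq_iff {X : Type*} (σ : Equiv.Perm X) (a b : X) :
    (Quotient.mk (Equiv.Perm.SameCycle.setoid σ) a = Quotient.mk (Equiv.Perm.SameCycle.setoid σ) b)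
      ↔ σ.SameCycle a b := by
  rw [Quotient.eq]; rfl

lemma sameCycle_out {X : Type*} (σ : Equiv.Perm X)
    (q : Quotient (Equiv.Perm.SameCycle.setoid σ)) : Quotient.mk _ q.out = q := Quotient.out_eq q

/-- one step of `σ` stays inside the relation -/
lemma sameCycle_induct {X : Type*} [Finite X] (σ : Equiv.Perm X) (r : X → X → Prop)
    (hr : Equivalence r) (h : ∀ z, r z (σ z)) {a b : X} (hab : σ.SameCycle a b) : r a b := by
  obtain ⟨i, hi⟩ := hab.exists_nat_pow_eq
  clear hab
  subst hi
  induction i with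
  | zero => exact hr.refl _
  | succ k ih =>
    rw [pow_succ', Equiv.Perm.mul_apply]
    exact hr.trans ih (h _)

lemma step_same {X : Type*} (σ : Equiv.Perm X) (z : X) : σ.SameCycle z (σ z) := by
  exact ⟨1, by simp⟩

lemma swap_join {X : Type*} [Finite X] [DecidableEq X] (σ : Equiv.Perm X) (x y : X) {a b : X}
    (hab : σ.SameCycle a b) :
    (σ * Equiv.swap x y).SameCycle a b ∨
    (((σ * Equiv.swap x y).SameCycle x a ∨ (σ * Equiv.swap x y).SameCycle y a) ∧
     ((σ * Equiv.swap x y).SameCycle x b ∨ (σ * Equiv.swap x y).SameCycle y b)) := by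
  set τ := σ * Equiv.swap x y with hτ
  refine sameCycle_induct σ (fun a b => τ.SameCycle a b ∨
    ((τ.SameCycle x a ∨ τ.SameCycle y a) ∧ (τ.SameCycle x b ∨ τ.SameCycle y b)))
    ⟨?_, ?_, ?_⟩ ?_ hab
  · intro a; exact Or.inl (Equiv.Perm.SameCycle.refl _ _)
  · rintro a b (h | h)
    · exact Or.inl h.symm
    · exact Or.inr h.symm
  · rintro a b c (h | ⟨h1, h2⟩) (h' | ⟨h1', h2'⟩)
    · exact Or.inl (h.trans h')
    · refine Or.inr ⟨h1'.imp (fun k => k.trans h.symm) (fun k => k.trans h.symm), h2'⟩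
    · refine Or.inr ⟨h1, h2.imp (fun k => k.trans h') (fun k => k.trans h')⟩
    · exact Or.inr ⟨h1, h2'⟩
  · intro z
    by_cases hx : z = x
    · subst hx
      right
      refine ⟨Or.inl (Equiv.Perm.SameCycle.refl _ _), Or.inr ?_⟩
      have := step_same τ y
      simpa [hτ, Equiv.Perm.mul_apply] using this
    by_cases hy : z = y
    · subst hy
      right
      refine ⟨Or.inr (Equiv.Perm.SameCycle.refl _ _), Or.inl ?_⟩
      have := step_same τ x
      simpa [hτ, Equiv.Perm.mul_apply] using this
    · left
      have := step_same τ z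
      have e : τ z = σ z := by
        rw [hτ, Equiv.Perm.mul_apply, Equiv.swap_apply_of_ne_of_ne hx hy]
      rwa [e] at this

/-- L2 -/
lemma cyc_swap_le {X : Type*} [Finite X] [DecidableEq X] (σ : Equiv.Perm X) (x y : X) :
    cyc (σ * Equiv.swap x y) ≤ cyc σ + 1 := by
  set τ := σ * Equiv.swap x y with hτ
  unfold cyc
  rw [← Finite.card_option]
  let f : Quotient (Equiv.Perm.SameCycle.setoid τ) →
      Option (Quotient (Equiv.Perm.SameCycle.setoid σ)) := fun q =>
    if q = Quotient.mk _ x then none else some (Quotient.mk _ q.out)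
  refine Nat.card_le_card_of_injective f ?_
  intro q q' h
  simp only [f] at h
  split_ifs at h with h1 h2 h2
  · rw [h1, h2]
  · rw [Option.some_inj, mk_eq_iff] at h
    rw [← sameCycle_out τ q] at h1 ⊢
    rw [← sameCycle_out τ q'] at h2 ⊢
    rw [mk_eq_iff] at h1 h2 ⊢
    rcases swap_join σ x y h with h | ⟨ha, hb⟩
    · exact h
    · rcases ha with ha | ha
      · exact absurd ha.symm h1
      rcases hb with hb | hb
      · exact absurd hb.symm h2
      exact ha.symm.trans hb

lemma not_same_swap {X : Type*} [Finite X] [DecidableEq X] (σ : Equiv.Perm X) {x y : X} (hxy : x ≠ y)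
    (h : σ.SameCycle x y) : ¬ (σ * Equiv.swap x y).SameCycle y x := by
  set τ := σ * Equiv.swap x y with hτ
  have hex : ∃ k : ℕ, (σ ^ k) x = y := h.exists_nat_pow_eq
  let k := Nat.find hex
  have hk : (σ ^ k) x = y := Nat.find_spec hex
  have hmin : ∀ j < k, (σ ^ j) x ≠ y := fun j hj => Nat.find_min hex hj
  have hk0 : 0 < k := by
    rcases Nat.eq_zero_or_pos k with h0 | h0
    · rw [h0] at hk; exact absurd hk hxy
    · exact h0
  have hx : ∀ i, 1 ≤ i → i ≤ k → (σ ^ i) x ≠ x := by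
    intro i h1 h2 he
    apply hmin (k - i) (by omega)
    have : (σ ^ k) x = (σ ^ (k - i)) ((σ ^ i) x) := by
      rw [← Equiv.Perm.mul_apply, ← pow_add, Nat.sub_add_cancel h2]
    rw [he, hk] at this
    exact this.symm
  intro hs
  obtain ⟨m, hm⟩ := hs.exists_nat_pow_eq
  have key : ∀ m : ℕ, ∃ i, 1 ≤ i ∧ i ≤ k ∧ (τ ^ m) y = (σ ^ i) x := by
    intro m
    induction m with
    | zero => exact ⟨k, hk0, le_rfl, hk.symm⟩
    | succ m ih =>
      obtain ⟨i, h1, h2, h3⟩ := ih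
      rw [pow_succ', Equiv.Perm.mul_apply, h3]
      rcases Nat.lt_or_ge i k with hi | hi
      · refine ⟨i + 1, by omega, hi, ?_⟩
        rw [hτ, Equiv.Perm.mul_apply, Equiv.swap_apply_of_ne_of_ne (hx i h1 h2) (hmin i hi),
          pow_succ', Equiv.Perm.mul_apply]
      · have : i = k := le_antisymm h2 hi
        subst this
        refine ⟨1, le_rfl, hk0, ?_⟩
        rw [hk, hτ, Equiv.Perm.mul_apply, Equiv.swap_apply_right, pow_one]
  obtain ⟨i, h1, h2, h3⟩ := key m
  exact hx i h1 h2 (h3.symm.trans hm)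

/-- L1 -/
lemma cyc_swap_ge {X : Type*} [Finite X] [DecidableEq X] (σ : Equiv.Perm X) {x y : X} (hxy : x ≠ y)
    (h : σ.SameCycle x y) : cyc σ + 1 ≤ cyc (σ * Equiv.swap x y) := by
  have hn := not_same_swap σ hxy h
  set τ := σ * Equiv.swap x y with hτ
  have hsub : ∀ {a b}, τ.SameCycle a b → σ.SameCycle a b := by
    intro a b hab
    refine sameCycle_induct τ (fun a b => σ.SameCycle a b) ⟨fun a => .refl _ _,
      fun h => h.symm, fun h h' => h.trans h'⟩ ?_ hab
    intro z
    have h2 : σ.SameCycle z (Equiv.swap x y z) := by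
      by_cases hx : z = x
      · subst hx; simpa using h
      by_cases hy : z = y
      · subst hy; simpa using h.symm
      rw [Equiv.swap_apply_of_ne_of_ne hx hy]
    exact h2.trans (step_same σ _)
  unfold cyc
  rw [← Finite.card_option]
  let f : Option (Quotient (Equiv.Perm.SameCycle.setoid σ)) →
      Quotient (Equiv.Perm.SameCycle.setoid τ) := fun o =>
    match o with
    | none => Quotient.mk _ x
    | some q => if q = Quotient.mk _ x then Quotient.mk _ y else Quotient.mk _ q.out
  refine Nat.card_le_card_of_injective f ?_
  have h1 : ∀ q, f none ≠ f (some q) := by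
    intro q he
    simp only [f] at he
    split_ifs at he with hq
    · rw [mk_eq_iff] at he
      exact hn he.symm
    · rw [mk_eq_iff] at he
      apply hq
      rw [← sameCycle_out σ q, mk_eq_iff]
      exact (hsub he).symm
  rintro (_ | q) (_ | q') he
  · rfl
  · exact absurd he (h1 _)
  · exact absurd he.symm (h1 _)
  · congr 1
    simp only [f] at he
    split_ifs at he with ha hb hb
    · rw [ha, hb]
    · rw [mk_eq_iff] at he
      rw [ha, ← sameCycle_out σ q', mk_eq_iff]
      exact h.trans (hsub he)
    · rw [mk_eq_iff] at he
      rw [hb, ← sameCycle_out σ q, mk_eq_iff]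
      exact (hsub he).trans h.symm
    · rw [mk_eq_iff] at he
      rw [← sameCycle_out σ q, ← sameCycle_out σ q', mk_eq_iff]
      exact hsub he

structure IsSig (n : ℕ) (α : Equiv.Perm (ZMod (2 * n))) (S : Set (ZMod (2 * n)))
    (σ : Equiv.Perm (ZMod (2 * n))) : Prop where
  mem : ∀ x ∈ S, σ x = α x + 1
  not_mem : ∀ x, x ∉ S → σ x = x + 1

lemma IsSig.swap {n : ℕ} {α : Equiv.Perm (ZMod (2 * n))} {S : Set (ZMod (2 * n))}
    {σ : Equiv.Perm (ZMod (2 * n))} (h : IsSig n α S σ) (hinv : ∀ x, α (α x) = x)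
    (hS : ∀ x ∈ S, α x ∈ S) {x : ZMod (2 * n)} (hx : x ∈ S) :
    IsSig n α (S \ {x, α x}) (σ * Equiv.swap x (α x)) := by
  constructor
  · rintro z ⟨hz, hz'⟩
    simp only [Set.mem_insert_iff, Set.mem_singleton_iff, not_or] at hz'
    rw [Equiv.Perm.mul_apply, Equiv.swap_apply_of_ne_of_ne hz'.1 hz'.2, h.mem z hz]
  · intro z hz
    by_cases h1 : z = x
    · subst h1
      rw [Equiv.Perm.mul_apply, Equiv.swap_apply_left, h.mem _ (hS _ hx), hinv]
    by_cases h2 : z = α x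
    · subst h2
      rw [Equiv.Perm.mul_apply, Equiv.swap_apply_right, h.mem _ hx]
    · rw [Equiv.Perm.mul_apply, Equiv.swap_apply_of_ne_of_ne h1 h2]
      apply h.not_mem
      intro hzS
      apply hz
      simp [hzS, h1, h2]

lemma diff_inv {n : ℕ} {α : Equiv.Perm (ZMod (2 * n))} {S : Set (ZMod (2 * n))}
    (hinv : ∀ x, α (α x) = x) (hS : ∀ x ∈ S, α x ∈ S) (x : ZMod (2 * n)) :
    ∀ z ∈ S \ {x, α x}, α z ∈ S \ {x, α x} := by
  rintro z ⟨hz, hz'⟩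
  simp only [Set.mem_insert_iff, Set.mem_singleton_iff, not_or] at hz'
  refine ⟨hS z hz, ?_⟩
  simp only [Set.mem_insert_iff, Set.mem_singleton_iff, not_or]
  refine ⟨fun h => hz'.2 ?_, fun h => hz'.1 (α.injective h)⟩
  rw [← h, hinv]

lemma pow_free {n : ℕ} {α : Equiv.Perm (ZMod (2 * n))} {S : Set (ZMod (2 * n))}
    {σ : Equiv.Perm (ZMod (2 * n))} (h : IsSig n α S σ) (z : ZMod (2 * n)) (m : ℕ)
    (hz : ∀ j < m, z + (j : ZMod (2 * n)) ∉ S) : (σ ^ m) z = z + m := by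
  induction m with
  | zero => simp
  | succ m ih =>
    rw [pow_succ', Equiv.Perm.mul_apply, ih (fun j hj => hz j (by omega)),
      h.not_mem _ (hz m (by omega))]
    push_cast; ring

lemma pow_first {n : ℕ} {α : Equiv.Perm (ZMod (2 * n))} {S : Set (ZMod (2 * n))}
    {σ : Equiv.Perm (ZMod (2 * n))} (h : IsSig n α S σ) {x : ZMod (2 * n)} (hx : x ∈ S) (m : ℕ)
    (hm : 0 < m)
    (hz : ∀ j, 0 < j → j < m → α x + (j : ZMod (2 * n)) ∉ S) : (σ ^ m) x = α x + m := by
  obtain ⟨m, rfl⟩ : ∃ k, m = k + 1 := ⟨m - 1, by omega⟩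
  rw [pow_succ, Equiv.Perm.mul_apply, h.mem x hx, pow_free h]
  · push_cast; ring
  · intro j hj
    have := hz (j + 1) (by omega) (by omega)
    push_cast at this
    rwa [add_assoc, add_comm 1]

lemma meets {n : ℕ} [NeZero (2 * n)] {α : Equiv.Perm (ZMod (2 * n))} {S : Set (ZMod (2 * n))}
    {σ : Equiv.Perm (ZMod (2 * n))} (h : IsSig n α S σ) (hS : S.Nonempty) (z : ZMod (2 * n)) :
    ∃ s ∈ S, σ.SameCycle z s := by
  obtain ⟨s, hs⟩ := hS
  have hex : ∃ j : ℕ, z + (j : ZMod (2 * n)) ∈ S := ⟨(s - z).val, by simpa using hs⟩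
  refine ⟨_, Nat.find_spec hex, (Nat.find hex : ℤ), ?_⟩
  rw [zpow_natCast]
  exact pow_free h z _ (fun j hj => Nat.find_min hex hj)

lemma firstAfter_spec {n : ℕ} [NeZero (2 * n)] {α : Equiv.Perm (ZMod (2 * n))}
    {S : Set (ZMod (2 * n))}
    {σ : Equiv.Perm (ZMod (2 * n))} (h : IsSig n α S σ) {x : ZMod (2 * n)} (hx : x ∈ S) :
    ∃ k : ℕ, 0 < k ∧ (σ ^ k) x = firstAfter n S (α x) ∧ firstAfter n S (α x) ∈ S ∧
      ∀ m, 0 < m → m < k → (σ ^ m) x ∉ S := by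
  have hex : ∃ k : ℕ, 0 < k ∧ α x + (k : ZMod (2 * n)) ∈ S := by
    refine ⟨(x - α x).val + 2 * n, ?_, ?_⟩
    · have := NeZero.ne (2 * n); omega
    · have e : ((2 * n : ℕ) : ZMod (2 * n)) = 0 := ZMod.natCast_self _
      rw [Nat.cast_add, e]; simpa using hx
  have hmin : ∀ j, 0 < j → j < Nat.find hex → α x + (j : ZMod (2 * n)) ∉ S :=
    fun j hj hj' hjS => Nat.find_min hex hj' ⟨hj, hjS⟩
  have hfa : firstAfter n S (α x) = α x + (Nat.find hex : ZMod (2 * n)) := by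
    unfold firstAfter; rw [dif_pos hex]
  refine ⟨Nat.find hex, (Nat.find_spec hex).1, ?_, ?_, ?_⟩
  · rw [hfa]; exact pow_first h hx _ (Nat.find_spec hex).1 hmin
  · rw [hfa]; exact (Nat.find_spec hex).2
  · intro m hm hm'
    rw [pow_first h hx m hm (fun j hj hj' => hmin j hj (by omega))]
    exact hmin m hm hm'

lemma eqvGen_iff {n : ℕ} [NeZero (2 * n)] {α : Equiv.Perm (ZMod (2 * n))}
    {S : Set (ZMod (2 * n))}
    {σ : Equiv.Perm (ZMod (2 * n))} (h : IsSig n α S σ) {x y : ZMod (2 * n)} (hx : x ∈ S)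
    (hy : y ∈ S) : Relation.EqvGen (boundaryStep n α S) x y ↔ σ.SameCycle x y := by
  constructor
  · intro he
    clear hx hy
    induction he with
    | rel a b hab =>
      obtain ⟨ha, rfl⟩ := hab
      obtain ⟨k, _, hk, _⟩ := firstAfter_spec h ha
      exact ⟨k, by rw [zpow_natCast]; exact hk⟩
    | refl a => exact .refl _ _
    | symm a b _ ih => exact ih.symm
    | trans a b c _ _ ih ih' => exact ih.trans ih'
  · intro hs
    obtain ⟨m, hm⟩ := hs.exists_nat_pow_eq
    clear hs
    induction m using Nat.strong_induction_on generalizing x with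
    | _ m ih =>
      rcases Nat.eq_zero_or_pos m with h0 | h0
      · subst h0
        simp at hm; subst hm; exact .refl _
      · obtain ⟨k, hk0, hk, hkS, hkm⟩ := firstAfter_spec h hx
        have hkle : k ≤ m := by
          by_contra hlt
          exact hkm m h0 (by omega) (hm ▸ hy)
        refine .trans _ _ _ (.rel _ _ ⟨hx, rfl⟩) (ih (m - k) (by omega) hkS ?_)
        rw [← hk, ← Equiv.Perm.mul_apply, ← pow_add, Nat.sub_add_cancel hkle, hm]

lemma cyc_empty {n : ℕ} [NeZero (2 * n)] {α : Equiv.Perm (ZMod (2 * n))}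
    {σ : Equiv.Perm (ZMod (2 * n))} (h : IsSig n α ∅ σ) : 
    (∀ a b, σ.SameCycle a b) ∧ cyc σ = 1 := by
  have hall : ∀ a b, σ.SameCycle a b := by
    intro a b
    refine ⟨((b - a).val : ℕ), ?_⟩
    rw [zpow_natCast, pow_free h _ _ (by simp)]
    simp
  refine ⟨hall, ?_⟩
  unfold cyc
  rw [Nat.card_eq_one_iff_unique]
  refine ⟨⟨?_⟩, ⟨Quotient.mk _ 0⟩⟩
  intro a b
  rw [← sameCycle_out σ a, ← sameCycle_out σ b, mk_eq_iff]
  exact hall _ _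

lemma orbitCount_eq {n : ℕ} [NeZero (2 * n)] {α : Equiv.Perm (ZMod (2 * n))}
    {S : Set (ZMod (2 * n))}
    {σ : Equiv.Perm (ZMod (2 * n))} (h : IsSig n α S σ) : orbitCount n α S = cyc σ := by
  unfold orbitCount
  split_ifs with hS
  · subst hS
    exact (cyc_empty h).2.symm
  · have hne : S.Nonempty := Set.nonempty_iff_ne_empty.mpr hS
    rw [← Nat.card_coe_set_eq]
    unfold cyc
    symm
    choose s hsS hs using meets h hne
    let F : ZMod (2 * n) → Set (ZMod (2 * n)) :=
      fun x => {y | Relation.EqvGen (boundaryStep n α S) x y}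
    have hF : ∀ a ∈ S, ∀ b ∈ S, (F a = F b ↔ σ.SameCycle a b) := by
      intro a ha b hb
      rw [← eqvGen_iff h ha hb]
      constructor
      · intro e
        have : b ∈ F b := Relation.EqvGen.refl b
        rw [← e] at this
        exact this
      · intro e
        ext z
        exact ⟨fun k => (e.symm _ _).trans _ _ _ k, fun k => e.trans _ _ _ k⟩
    refine Nat.card_eq_of_bijective
      (fun q => (⟨F (s q.out), s q.out, hsS _, rfl⟩ : (F '' S : Set _))) ⟨?_, ?_⟩
    · intro q q' e
      have e' : F (s q.out) = F (s q'.out) := congrArg Subtype.val e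
      rw [hF _ (hsS _) _ (hsS _)] at e'
      rw [← sameCycle_out σ q, ← sameCycle_out σ q', mk_eq_iff]
      exact ((hs _).trans e').trans (hs _).symm
    · rintro ⟨_, x, hx, rfl⟩
      refine ⟨Quotient.mk _ x, ?_⟩
      apply Subtype.ext
      show F _ = F x
      rw [hF _ (hsS _) _ hx]
      refine (hs _).symm.trans ?_
      rw [← mk_eq_iff, sameCycle_out]

lemma cyc_bound {n : ℕ} [NeZero (2 * n)] {α : Equiv.Perm (ZMod (2 * n))}
    (hinv : ∀ x, α (α x) = x) (hfree : ∀ x, α x ≠ x) (k : ℕ) :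
    ∀ (S : Set (ZMod (2 * n))) (σ : Equiv.Perm (ZMod (2 * n))), IsSig n α S σ →
    (∀ x ∈ S, α x ∈ S) → S.ncard ≤ 2 * k → cyc σ ≤ k + 1 := by
  induction k with
  | zero =>
    intro S σ h hS hc
    have : S = ∅ := by
      rw [← Set.ncard_eq_zero (Set.toFinite S)]; omega
    subst this
    rw [(cyc_empty h).2]
  | succ k ih =>
    intro S σ h hS hc
    rcases S.eq_empty_or_nonempty with rfl | ⟨x, hx⟩
    · rw [(cyc_empty h).2]; omega
    · have hsub : ({x, α x} : Set (ZMod (2 * n))) ⊆ S := by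
        rintro z (rfl | rfl)
        · exact hx
        · exact hS _ hx
      have hd := Set.ncard_sdiff_add_ncard_of_subset hsub (Set.toFinite S)
      rw [Set.ncard_pair (hfree x).symm] at hd
      have h1 := ih _ _ (h.swap hinv hS hx) (diff_inv hinv hS x) (by omega)
      have h2 := cyc_swap_le (σ * Equiv.swap x (α x)) x (α x)
      rw [show σ * Equiv.swap x (α x) * Equiv.swap x (α x) = σ by ext z; simp] at h2
      omega

theorem every_edge_type_up (n : ℕ) (hn : 1 ≤ n) (α : Equiv.Perm (ZMod (2 * n)))
    (hinv : ∀ x, α (α x) = x) (hfree : ∀ x, α x ≠ x)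
    (hconn : (interGraph n α).Connected)
    (hgenus : ∀ S : Set (ZMod (2 * n)), (∀ x ∈ S, α x ∈ S) →
      pdGenus n α S = pdGenus n α ∅) :
    ∀ x : ZMod (2 * n), ¬ (faceMap n α).SameCycle x (α x) := by
  intro x hx
  have : NeZero (2 * n) := ⟨by omega⟩
  have hE : IsSig n α Set.univ (faceMap n α) := ⟨fun _ _ => rfl, fun z hz => absurd trivial hz⟩
  have h0 : IsSig n α ∅ (Equiv.addRight 1) := ⟨fun z hz => absurd hz (by simp), fun _ _ => rfl⟩
  have hE' := hE.swap hinv (fun _ _ => trivial) (Set.mem_univ x)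
  have hcompl : (Set.univ \ {x, α x} : Set (ZMod (2 * n))) = ({x, α x} : Set _)ᶜ := by
    ext z; simp
  rw [hcompl] at hE'
  have h1 : IsSig n α {x, α x} (Equiv.addRight 1 * Equiv.swap x (α x)) := by
    constructor
    · rintro z (rfl | rfl)
      · simp [Equiv.Perm.mul_apply]
      · simp [Equiv.Perm.mul_apply, hinv]
    · intro z hz
      simp only [Set.mem_insert_iff, Set.mem_singleton_iff, not_or] at hz
      rw [Equiv.Perm.mul_apply, Equiv.swap_apply_of_ne_of_ne hz.1 hz.2]
      rfl
  have g1 := cyc_swap_ge _ (hfree x).symm ((cyc_empty h0).1 x (α x))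
  rw [(cyc_empty h0).2, ← orbitCount_eq h1] at g1
  have g2 := cyc_swap_ge _ (hfree x).symm hx
  have hpair := Set.ncard_add_ncard_compl ({x, α x} : Set (ZMod (2 * n)))
  rw [Set.ncard_pair (hfree x).symm, Nat.card_zmod] at hpair
  have hinv2 : ∀ z ∈ ({x, α x} : Set (ZMod (2 * n)))ᶜ, α z ∈ ({x, α x} : Set (ZMod (2 * n)))ᶜ := by
    have := diff_inv hinv (S := Set.univ) (fun _ _ => trivial) x
    rwa [hcompl] at this
  have g3 := cyc_bound hinv hfree (n - 1) _ _ hE' hinv2 (by omega)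
  rw [← orbitCount_eq hE'] at g2 g3
  rw [← orbitCount_eq hE] at g2
  have g4 : orbitCount n α ∅ = 1 := by unfold orbitCount; simp
  have hg := hgenus {x, α x} (by
    rintro z (rfl | rfl)
    · simp
    · simp [hinv])
  unfold pdGenus at hg
  rw [Set.compl_empty, g4] at hg
  omega
end

section
/- Let n ≥ 1 and let α_n be the involution x ↦ x + n of ZMod (2n) (the chord diagram B_n). The permutation ρ ∘ α_n of ZMod (2n) has exactly 2 orbits when n is odd and exactly 1 orbit when n is even; consequently the one-vertex ribbon graph B_n has genus (n − 1)/2 when n is odd and genus n/2 when n is even. -/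
open scoped Classical

lemma fm_zpow (n : ℕ) (i : ℤ) (z : ZMod (2 * n)) :
    ((faceMap n (bn n)) ^ i) z = z + (i : ZMod (2 * n)) * ((n : ZMod (2 * n)) + 1) := by
  have h : faceMap n (bn n) = Equiv.addRight ((n : ZMod (2 * n)) + 1) := by
    ext x
    simp [faceMap, bn, add_assoc]
  rw [h]
  induction i generalizing z with
  | zero => simp
  | succ i ih =>
    rw [zpow_add_one, Equiv.Perm.mul_apply, ih, Equiv.coe_addRight]
    push_cast
    ring
  | pred i ih =>
    rw [zpow_sub_one, Equiv.Perm.mul_apply, ih, Equiv.Perm.inv_def, Equiv.addRight_symm,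
      Equiv.coe_addRight]
    push_cast
    ring

lemma sc_iff (n : ℕ) (a b : ℤ) :
    (faceMap n (bn n)).SameCycle (a : ZMod (2 * n)) (b : ZMod (2 * n)) ↔
      ∃ i : ℤ, (2 * n : ℤ) ∣ b - (a + i * (n + 1)) := by
  unfold Equiv.Perm.SameCycle
  refine exists_congr fun i => ?_
  rw [fm_zpow]
  have := ZMod.intCast_eq_intCast_iff_dvd_sub (a + i * (n + 1)) b (2 * n)
  push_cast at this
  exact this

lemma sc_of (n : ℕ) (a b : ℤ) (h : (2 : ℤ) ∣ (b - a) * n) :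
    (faceMap n (bn n)).SameCycle (a : ZMod (2 * n)) (b : ZMod (2 * n)) := by
  rw [sc_iff]
  obtain ⟨c, hc⟩ := h
  refine ⟨(b - a) * (n + 1), -(b - a + c), ?_⟩
  linear_combination (-(n : ℤ)) * hc

lemma orbit_eq (n : ℕ) {a b : ZMod (2 * n)} :
    faceOrbit n (bn n) a = faceOrbit n (bn n) b ↔ (faceMap n (bn n)).SameCycle a b := by
  constructor
  · intro h
    have : b ∈ faceOrbit n (bn n) a := by
      rw [h]
      exact Equiv.Perm.SameCycle.refl _ _
    exact this
  · intro h
    ext w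
    exact ⟨fun h' => h.symm.trans h', fun h' => h.trans h'⟩

lemma faces_even (n : ℕ) (h : Even n) : numFaces n (bn n) = 1 := by
  unfold numFaces
  rw [Set.ncard_eq_one]
  refine ⟨faceOrbit n (bn n) ((0 : ℤ) : ZMod (2 * n)), ?_⟩
  ext s
  simp only [Set.mem_range, Set.mem_singleton_iff]
  constructor
  · rintro ⟨y, rfl⟩
    obtain ⟨b, rfl⟩ := ZMod.intCast_surjective y
    rw [orbit_eq]
    apply sc_of
    exact Dvd.dvd.mul_left (by exact_mod_cast h.two_dvd) _
  · rintro rfl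
    exact ⟨_, rfl⟩

lemma faces_odd (n : ℕ) (h : Odd n) : numFaces n (bn n) = 2 := by
  unfold numFaces
  rw [Set.ncard_eq_two]
  refine ⟨faceOrbit n (bn n) ((0 : ℤ) : ZMod (2 * n)),
    faceOrbit n (bn n) ((1 : ℤ) : ZMod (2 * n)), ?_, ?_⟩
  · rw [Ne, orbit_eq, sc_iff]
    rintro ⟨i, c, hc⟩
    obtain ⟨k, rfl⟩ := h
    push_cast at hc
    have : (1 : ℤ) = 2 * ((2 * k + 1) * c + i * (k + 1)) := by linear_combination hc
    omega
  ext s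
  simp only [Set.mem_range, Set.mem_insert_iff, Set.mem_singleton_iff]
  constructor
  · rintro ⟨y, rfl⟩
    obtain ⟨b, rfl⟩ := ZMod.intCast_surjective y
    rw [orbit_eq, orbit_eq]
    rcases Int.even_or_odd b with hb | hb
    · left
      apply sc_of
      exact Dvd.dvd.mul_right (by obtain ⟨c, hc⟩ := hb; omega) _
    · right
      apply sc_of
      exact Dvd.dvd.mul_right (by obtain ⟨c, hc⟩ := hb; omega) _
  · rintro (rfl | rfl)
    · exact ⟨_, rfl⟩
    · exact ⟨_, rfl⟩

/-- The permutation `ρ ∘ α_n` for `B_n` has 2 orbits when `n` is odd and 1 orbit when `n`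
is even; consequently the genus `(2 − 1 + n − F)/2` of `B_n` is `(n − 1)/2` when `n` is odd
and `n/2` when `n` is even. -/
theorem faces_and_genus_of_Bn (n : ℕ) (hn : 1 ≤ n) :
    (Odd n → numFaces n (bn n) = 2 ∧
      (2 - 1 + n - numFaces n (bn n)) / 2 = (n - 1) / 2) ∧
    (Even n → numFaces n (bn n) = 1 ∧
      (2 - 1 + n - numFaces n (bn n)) / 2 = n / 2) := by
  refine ⟨fun h => ?_, fun h => ?_⟩
  · rw [faces_odd n h]
    exact ⟨rfl, by omega⟩
  · rw [faces_even n h]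
    exact ⟨rfl, by omega⟩
end

section
/- Let n ≥ 1 and let α_n be the involution x ↦ x + n of ZMod (2n) (the chord diagram B_n). If n is odd then for every x ∈ ZMod (2n) the points x and x + n lie in different orbits of ρ ∘ α_n (every edge of B_n is of Type up), while if n is even then for every x the points x and x + n lie in the same orbit of ρ ∘ α_n (every edge of B_n is of Type uu). -/
open scoped Classical

theorem faceMap_bn_zpow (n : ℕ) (k : ℤ) (x : ZMod (2 * n)) :
    ((faceMap n (bn n)) ^ k) x = x + ((k * (n + 1) : ℤ) : ZMod (2 * n)) := by
  have h : faceMap n (bn n) = Equiv.addRight ((n : ZMod (2 * n)) + 1) := by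
    ext y
    simp [faceMap, bn, add_assoc]
  rw [h]
  induction k generalizing x with
  | zero => simp
  | succ i ih =>
    rw [zpow_add_one, Equiv.Perm.mul_apply, ih]
    simp only [Equiv.coe_addRight]
    push_cast
    ring
  | pred i ih =>
    rw [zpow_sub_one, Equiv.Perm.mul_apply, ih]
    have e : (Equiv.addRight ((n : ZMod (2 * n)) + 1))⁻¹ x = x - (n + 1) := by
      rw [Equiv.Perm.inv_eq_iff_eq]
      simp only [Equiv.coe_addRight]
      ring
    rw [e]
    push_cast
    ring

/-- For `B_n`: if `n` is odd then every edge is of Type `up` (the endpoints `x` and `x + n`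
of each chord lie in different orbits of `ρ ∘ α_n`), and if `n` is even then every edge is
of Type `uu` (the endpoints lie in the same orbit). -/
theorem Bn_edge_types (n : ℕ) (hn : 1 ≤ n) :
    (Odd n → ∀ x : ZMod (2 * n),
      ¬ (faceMap n (bn n)).SameCycle x (x + (n : ZMod (2 * n)))) ∧
    (Even n → ∀ x : ZMod (2 * n),
      (faceMap n (bn n)).SameCycle x (x + (n : ZMod (2 * n)))) := by
  constructor
  · rintro ⟨m, hm⟩ x ⟨k, hk⟩
    rw [faceMap_bn_zpow] at hk
    have h1 := add_left_cancel hk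
    have h2 : ((k * (n + 1) : ℤ) : ZMod (2 * n)) = ((n : ℤ) : ZMod (2 * n)) := by
      rw [h1]; simp
    rw [ZMod.intCast_eq_intCast_iff_dvd_sub] at h2
    obtain ⟨c, hc⟩ := h2
    subst hm
    push_cast at hc
    have h3 : (2 : ℤ) * ((2 * m + 1) * c + k * (m + 1) - m) = 1 := by linarith
    omega
  · rintro ⟨m, hm⟩ x
    refine ⟨n, ?_⟩
    rw [faceMap_bn_zpow]
    congr 1
    have h2 : (((n : ℤ) * (n + 1) : ℤ) : ZMod (2 * n)) = ((n : ℤ) : ZMod (2 * n)) := by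
      rw [ZMod.intCast_eq_intCast_iff_dvd_sub]
      refine ⟨-m, ?_⟩
      subst hm
      push_cast
      ring
    rw [h2]; simp
end

section
/- Let n ≥ 1 and let α_n be the involution x ↦ x + n of ZMod (2n) (the chord diagram B_n). For every nonempty set A of chords of B_n, the boundary-component count satisfies c(A) = 2 if |A| is odd and c(A) = 1 if |A| is even (any set of k pairwise interlacing chords forms a copy of B_k). -/
open scoped Classical

theorem bnaux_count (p : ℕ → Prop) (n : ℕ) (hp : ∀ m, p (m + n) ↔ p m) (m : ℕ) :
    Nat.count p (m + n) = Nat.count p m + Nat.count p n := by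
  induction m with
  | zero => simp
  | succ m ih =>
    have : m + 1 + n = (m + n) + 1 := by omega
    rw [this, Nat.count_succ, Nat.count_succ, ih]
    simp only [hp]
    omega

theorem bnaux_nth (p : ℕ → Prop) (n : ℕ) (hp : ∀ m, p (m + n) ↔ p m)
    (hinf : (Set.ofPred p).Infinite) (j : ℕ) :
    Nat.nth p (j + Nat.count p n) = Nat.nth p j + n := by
  have h1 : p (Nat.nth p j + n) := (hp _).2 (Nat.nth_mem_of_infinite hinf j)
  have h2 := Nat.nth_count h1
  rw [bnaux_count p n hp, Nat.count_nth_of_infinite hinf] at h2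
  exact h2

theorem bnaux_mod (p : ℕ → Prop) (n : ℕ) (hp : ∀ m, p (m + n) ↔ p m) (m : ℕ) :
    Nat.count p (m % (2 * n)) % 2 = Nat.count p m % 2 := by
  have key : ∀ t r : ℕ, Nat.count p (r + 2 * n * t) % 2 = Nat.count p r % 2 := by
    intro t
    induction t with
    | zero => simp
    | succ t ih =>
      intro r
      have : r + 2 * n * (t + 1) = (r + 2 * n * t) + n + n := by ring
      rw [this, bnaux_count p n hp, bnaux_count p n hp]
      have := ih r
      omega
  have := key (m / (2 * n)) (m % (2 * n))
  rw [Nat.mod_add_div] at this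
  exact this.symm

theorem bnaux_first (n : ℕ) (S : Set (ZMod (2 * n)))
    (hinf : (Set.ofPred (fun m : ℕ => (m : ZMod (2 * n)) ∈ S)).Infinite) (j : ℕ) :
    firstAfter n S ((Nat.nth (fun m : ℕ => (m : ZMod (2 * n)) ∈ S) j : ℕ) : ZMod (2 * n)) =
      ((Nat.nth (fun m : ℕ => (m : ZMod (2 * n)) ∈ S) (j + 1) : ℕ) : ZMod (2 * n)) := by
  set p : ℕ → Prop := fun m : ℕ => (m : ZMod (2 * n)) ∈ S with hpdef
  have hlt : Nat.nth p j < Nat.nth p (j + 1) := Nat.nth_strictMono hinf (Nat.lt_succ_self j)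
  obtain ⟨d, hd⟩ := Nat.exists_eq_add_of_lt hlt
  have hmem : p (Nat.nth p (j + 1)) := Nat.nth_mem_of_infinite hinf (j + 1)
  have hP : 0 < d + 1 ∧ ((Nat.nth p j : ℕ) : ZMod (2 * n)) + ((d + 1 : ℕ) : ZMod (2 * n)) ∈ S := by
    refine ⟨by omega, ?_⟩
    rw [← Nat.cast_add, ← add_assoc, ← hd]
    exact hmem
  have hex : ∃ k : ℕ, 0 < k ∧ ((Nat.nth p j : ℕ) : ZMod (2 * n)) + (k : ZMod (2 * n)) ∈ S :=
    ⟨_, hP⟩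
  unfold firstAfter
  rw [dif_pos hex]
  have hf : Nat.find hex = d + 1 := by
    rw [Nat.find_eq_iff]
    refine ⟨hP, ?_⟩
    rintro m hm ⟨h0, h1⟩
    rw [← Nat.cast_add] at h1
    have := Nat.le_nth_of_lt_nth_succ (p := p) (k := j) (a := Nat.nth p j + m) (by omega) h1
    omega
  rw [hf, ← Nat.cast_add, hd, add_assoc]

theorem bnaux_card (n : ℕ) (hn : 1 ≤ n) (S : Set (ZMod (2 * n))) :
    S.ncard = Nat.count (fun m : ℕ => (m : ZMod (2 * n)) ∈ S) (2 * n) := by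
  have : NeZero (2 * n) := ⟨by omega⟩
  rw [Nat.count_eq_card_filter_range, ← Set.ncard_coe_finset]
  symm
  apply Set.ncard_congr (fun (m : ℕ) _ => (m : ZMod (2 * n)))
  · intro a ha
    simpa using (Finset.mem_filter.1 (Finset.mem_coe.1 ha)).2
  · intro a b ha hb hab
    have ha := (Finset.mem_filter.1 (Finset.mem_coe.1 ha)).1
    have hb := (Finset.mem_filter.1 (Finset.mem_coe.1 hb)).1
    rw [Finset.mem_range] at ha hb
    have := congrArg ZMod.val hab
    simpa [ZMod.val_natCast, Nat.mod_eq_of_lt ha, Nat.mod_eq_of_lt hb] using this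
  · intro b hb
    refine ⟨b.val, ?_, by simp⟩
    simp [ZMod.val_lt, hb]

theorem Bn_subdiagram_boundary_count (n : ℕ) (hn : 1 ≤ n)
    (S : Set (ZMod (2 * n))) (hne : S ≠ ∅) (hinv : ∀ x ∈ S, bn n x ∈ S) :
    (Odd (S.ncard / 2) → orbitCount n (bn n) S = 2) ∧
    (Even (S.ncard / 2) → orbitCount n (bn n) S = 1) := by
  have : NeZero (2 * n) := ⟨by omega⟩
  have hcard := bnaux_card n hn S
  have hfirst := bnaux_first n S
  set p : ℕ → Prop := fun m : ℕ => (m : ZMod (2 * n)) ∈ S with hpdef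
  have hnn : (n : ZMod (2 * n)) + n = 0 := by
    have := ZMod.natCast_self (2 * n)
    rw [Nat.cast_mul, Nat.cast_two] at this
    rw [← this]; ring
  have hinv' : ∀ x ∈ S, x + (n : ZMod (2 * n)) ∈ S := fun x hx => hinv x hx
  have hp : ∀ m, p (m + n) ↔ p m := by
    intro m
    simp only [hpdef, Nat.cast_add]
    refine ⟨fun h => ?_, fun h => hinv' _ h⟩
    have := hinv' _ h
    rwa [add_assoc, hnn, add_zero] at this
  obtain ⟨x0, hx0⟩ := Set.nonempty_iff_ne_empty.2 hne
  have hinf : (Set.ofPred p).Infinite := by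
    rw [Set.infinite_iff_exists_gt]
    intro a
    refine ⟨x0.val + 2 * n * (a + 1), ?_, ?_⟩
    · change ((x0.val + 2 * n * (a + 1) : ℕ) : ZMod (2 * n)) ∈ S
      rw [Nat.cast_add, Nat.cast_mul, ZMod.natCast_self]
      simpa using hx0
    · nlinarith
  have hfirst := hfirst hinf
  set k := Nat.count p n with hk
  have hc2 : S.ncard / 2 = k := by
    have h1 := bnaux_count p n hp n
    rw [show n + n = 2 * n by ring] at h1
    have h2 : S.ncard = Nat.count p (2 * n) := by
      rw [hcard]
    omega
  rw [hc2]
  have hnth := bnaux_nth p n hp hinf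
  rw [← hk] at hnth
  set f : ℕ → ZMod (2 * n) := fun j => ((Nat.nth p j : ℕ) : ZMod (2 * n)) with hf
  have hfS : ∀ j, f j ∈ S := fun j => Nat.nth_mem_of_infinite hinf j
  have hSf : ∀ x ∈ S, ∃ j, f j = x := by
    intro x hx
    have hpx : p x.val := by simpa [hpdef] using hx
    refine ⟨Nat.count p x.val, ?_⟩
    simp only [hf]
    rw [Nat.nth_count hpx]; simp
  have hper : ∀ j, f (j + 2 * k) = f j := by
    intro j
    simp only [hf]
    rw [show j + 2 * k = j + k + k by ring, hnth, hnth, Nat.cast_add, Nat.cast_add, add_assoc, hnn, add_zero]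
  have hstep' : ∀ j, firstAfter n S (bn n (f j)) = f (j + k + 1) := by
    intro j
    have : bn n (f j) = ((Nat.nth p (j + k) : ℕ) : ZMod (2 * n)) := by
      rw [hnth, Nat.cast_add]; rfl
    rw [this, hfirst]
  set E := Relation.EqvGen (boundaryStep n (bn n) S) with hE
  have hsy : ∀ {a b}, E a b → E b a := fun h => Relation.EqvGen.symm _ _ h
  have htr : ∀ {a b c}, E a b → E b c → E a c := fun h g => Relation.EqvGen.trans _ _ _ h g
  have hrf : ∀ a, E a a := fun a => Relation.EqvGen.refl a
  have hstep : ∀ j, E (f j) (f (j + k + 1)) := fun j =>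
    Relation.EqvGen.rel _ _ ⟨hfS j, (hstep' j).symm⟩
  have htwo : ∀ j, E (f j) (f (j + 2)) := by
    intro j
    have h := htr (hstep j) (hstep (j + k + 1))
    rwa [show j + k + 1 + k + 1 = j + 2 + 2 * k by ring, hper] at h
  have heven : ∀ m j, E (f j) (f (j + 2 * m)) := by
    intro m
    induction m with
    | zero => intro j; exact hrf _
    | succ m ih => intro j; exact htr (ih j) (htwo _)
  have hclass : ∀ x y, E x y → {z | E x z} = {z | E y z} := by
    intro x y h
    ext z
    exact ⟨fun g => htr (hsy h) g, fun g => htr h g⟩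
  unfold orbitCount
  rw [if_neg hne]
  constructor
  · intro hodd
    have hpar : ∀ x y, E x y → Nat.count p x.val % 2 = Nat.count p y.val % 2 := by
      have hfp : ∀ j, Nat.count p (f j).val % 2 = j % 2 := by
        intro j
        simp only [hf]
        rw [ZMod.val_natCast, bnaux_mod p n hp, Nat.count_nth_of_infinite hinf]
      intro x y h
      induction h with
      | rel x y h =>
        obtain ⟨hx, rfl⟩ := h
        obtain ⟨j, rfl⟩ := hSf x hx
        rw [hstep', hfp, hfp]
        obtain ⟨t, ht⟩ := hodd
        omega
      | refl x => rfl
      | symm x y _ ih => exact ih.symm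
      | trans x y z _ _ h1 h2 => exact h1.trans h2
    have hfp : ∀ j, Nat.count p (f j).val % 2 = j % 2 := by
      intro j
      simp only [hf]
      rw [ZMod.val_natCast, bnaux_mod p n hp, Nat.count_nth_of_infinite hinf]
    have himg : (fun x => {y | E x y}) '' S = {{y | E (f 0) y}, {y | E (f 1) y}} := by
      ext C
      simp only [Set.mem_image, Set.mem_insert_iff, Set.mem_singleton_iff]
      constructor
      · rintro ⟨x, hx, rfl⟩
        obtain ⟨j, rfl⟩ := hSf x hx
        rcases Nat.even_or_odd' j with ⟨m, rfl | rfl⟩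
        · left
          apply hclass
          have := heven m 0
          rw [zero_add] at this
          exact hsy this
        · right
          apply hclass
          have := heven m 1
          rw [add_comm] at this
          exact hsy this
      · rintro (rfl | rfl)
        · exact ⟨f 0, hfS 0, rfl⟩
        · exact ⟨f 1, hfS 1, rfl⟩
    rw [himg]
    apply Set.ncard_pair
    intro h
    have h1 : f 1 ∈ {y | E (f 0) y} := by rw [h]; exact hrf _
    have := hpar _ _ h1
    rw [hfp, hfp] at this
    omega
  · rintro ⟨m, hm⟩
    have hone : ∀ j, E (f 0) (f j) := by
      intro j
      induction j with
      | zero => exact hrf _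
      | succ j ih =>
        refine htr ih (htr (hstep j) (hsy ?_))
        have := heven m (j + 1)
        rwa [show j + 1 + 2 * m = j + k + 1 by omega] at this
    rw [Set.ncard_eq_one]
    refine ⟨{y | E (f 0) y}, ?_⟩
    ext C
    simp only [Set.mem_image, Set.mem_singleton_iff]
    constructor
    · rintro ⟨x, hx, rfl⟩
      obtain ⟨j, rfl⟩ := hSf x hx
      exact hclass _ _ (hsy (hone j))
    · rintro rfl
      exact ⟨f 0, hfS 0, rfl⟩
end

section
/- Let n be even, n ≥ 2, and let α_n be the involution x ↦ x + n of ZMod (2n) (the chord diagram B_n). Then the partial-dual genus polynomial of B_n is not a monomial: g(B_n, ∅) = n/2, while g(B_n, A) = (n − 2)/2 for any set A consisting of a single chord; hence there exist partial duals of B_n of different genera. -/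
open scoped Classical

lemma aux_firstAfter {n : ℕ} {S : Set (ZMod (2 * n))} {y : ZMod (2 * n)} (k : ℕ) (hk : 0 < k)
    (hy : y + (k : ZMod (2 * n)) ∈ S)
    (hm : ∀ m : ℕ, 0 < m → m < k → y + (m : ZMod (2 * n)) ∉ S) :
    firstAfter n S y = y + (k : ZMod (2 * n)) := by
  have h : ∃ k : ℕ, 0 < k ∧ y + (k : ZMod (2 * n)) ∈ S := ⟨k, hk, hy⟩
  unfold firstAfter
  rw [dif_pos h]
  have : Nat.find h = k := by
    rw [Nat.find_eq_iff]
    refine ⟨⟨hk, hy⟩, fun m hmk hh => hm m hh.1 hmk hh.2⟩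
  rw [this]

lemma aux_eqv_set {α : Type*} {r : α → α → Prop} {a b : α} (h : Relation.EqvGen r a b) :
    {y | Relation.EqvGen r a y} = {y | Relation.EqvGen r b y} := by
  ext y
  exact ⟨fun h' => (h.symm _ _).trans _ _ _ h', fun h' => h.trans _ _ _ h'⟩

lemma aux_count_two {n : ℕ} {α : Equiv.Perm (ZMod (2 * n))} {S : Set (ZMod (2 * n))}
    (f : ZMod (2 * n) → Prop) (hf : ∀ x ∈ S, (f x ↔ f (firstAfter n S (α x))))
    (a b : ZMod (2 * n)) (ha : a ∈ S) (hb : b ∈ S) (hab : ¬ (f a ↔ f b))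
    (hall : ∀ y ∈ S, Relation.EqvGen (boundaryStep n α S) a y ∨
      Relation.EqvGen (boundaryStep n α S) b y) : orbitCount n α S = 2 := by
  unfold orbitCount
  rw [if_neg (Set.Nonempty.ne_empty ⟨a, ha⟩)]
  have hinv : ∀ u v, Relation.EqvGen (boundaryStep n α S) u v → (f u ↔ f v) := by
    intro u v h
    induction h with
    | rel u v h => obtain ⟨h1, rfl⟩ := h; exact hf u h1
    | refl => rfl
    | symm _ _ _ ih => exact ih.symm
    | trans _ _ _ _ _ i1 i2 => exact i1.trans i2
  rw [Set.ncard_eq_two]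
  refine ⟨{y | Relation.EqvGen (boundaryStep n α S) a y},
    {y | Relation.EqvGen (boundaryStep n α S) b y}, ?_, ?_⟩
  · intro h
    have : b ∈ {y | Relation.EqvGen (boundaryStep n α S) a y} := by
      rw [h]; exact Relation.EqvGen.refl b
    exact hab (hinv _ _ this)
  · ext T
    simp only [Set.mem_image, Set.mem_insert_iff, Set.mem_singleton_iff]
    constructor
    · rintro ⟨y, hy, rfl⟩
      rcases hall y hy with h | h
      · left; exact (aux_eqv_set h).symm
      · right; exact (aux_eqv_set h).symm
    · rintro (rfl | rfl)
      · exact ⟨a, ha, rfl⟩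
      · exact ⟨b, hb, rfl⟩

lemma aux_cast_eq {N a b : ℕ} (ha : a < N) (hb : b < N) :
    ((a : ZMod N) = (b : ZMod N)) ↔ a = b := by
  rw [ZMod.natCast_eq_natCast_iff', Nat.mod_eq_of_lt ha, Nat.mod_eq_of_lt hb]

lemma aux_two (n : ℕ) : (n : ZMod (2 * n)) + (n : ZMod (2 * n)) = 0 := by
  have := ZMod.natCast_self (2 * n)
  push_cast at this
  rw [← this]; ring

lemma aux_count_univ (n : ℕ) (hn : 2 ≤ n) (heven : Even n) :
    orbitCount n (bn n) Set.univ = 1 := by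
  haveI : NeZero (2 * n) := ⟨by omega⟩
  unfold orbitCount
  rw [if_neg Set.univ_nonempty.ne_empty, Set.ncard_eq_one]
  have hstep : ∀ z : ZMod (2 * n), firstAfter n Set.univ (bn n z) = z + ((n + 1 : ℕ) : ZMod (2 * n)) := by
    intro z
    rw [aux_firstAfter 1 one_pos (Set.mem_univ _) (by intros; omega)]
    simp [bn]; ring
  have hit : ∀ (k : ℕ), Relation.EqvGen (boundaryStep n (bn n) Set.univ) 0
      ((k * (n + 1) : ℕ) : ZMod (2 * n)) := by
    intro k
    induction k with
    | zero => simp; exact Relation.EqvGen.refl _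
    | succ k ih =>
      refine ih.trans _ _ _ (Relation.EqvGen.rel _ _ ⟨Set.mem_univ _, ?_⟩)
      rw [hstep]; push_cast; ring
  have hall : ∀ z : ZMod (2 * n), Relation.EqvGen (boundaryStep n (bn n) Set.univ) 0 z := by
    intro z
    have hc : Nat.Coprime (n + 1) (2 * n) := by
      apply Nat.Coprime.mul_right
      · rw [Nat.coprime_two_right]; exact heven.add_one
      · simp
    have := hit ((z * ((n + 1 : ℕ) : ZMod (2 * n))⁻¹).val)
    rw [Nat.cast_mul, ZMod.natCast_zmod_val, mul_assoc, mul_comm (_⁻¹),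
      ZMod.coe_mul_inv_eq_one _ hc, mul_one] at this
    exact this
  refine ⟨{y | Relation.EqvGen (boundaryStep n (bn n) Set.univ) 0 y}, ?_⟩
  ext T
  simp only [Set.mem_image, Set.mem_singleton_iff]
  constructor
  · rintro ⟨y, -, rfl⟩
    exact (aux_eqv_set (hall y)).symm
  · rintro rfl
    exact ⟨0, Set.mem_univ _, rfl⟩

lemma aux_count_pair (n : ℕ) (hn : 2 ≤ n) (x : ZMod (2 * n)) :
    orbitCount n (bn n) {x, x + (n : ZMod (2 * n))} = 2 := by
  have h2 := aux_two n
  have hne : ∀ m : ℕ, 0 < m → m < 2 * n → (m : ZMod (2 * n)) ≠ 0 := by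
    intro m h0 h1 h
    rw [← Nat.cast_zero, aux_cast_eq h1 (by omega)] at h
    omega
  have hnx : x + (n : ZMod (2 * n)) ≠ x := by
    simpa using hne n (by omega) (by omega)
  have e1 : firstAfter n {x, x + (n : ZMod (2 * n))} (bn n x) = x := by
    rw [aux_firstAfter n (by omega)]
    · simp [bn, add_assoc, h2]
    · left; simp [bn, add_assoc, h2]
    · intro m h0 h1 h
      rcases h with h | h
      · apply hne (n + m) (by omega) (by omega)
        simp only [bn, Equiv.coe_addRight, add_assoc] at h
        simpa using h
      · apply hne m (by omega) (by omega)
        simpa [bn] using h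
  have e2 : firstAfter n {x, x + (n : ZMod (2 * n))} (bn n (x + (n : ZMod (2 * n)))) = x + n := by
    have hb : bn n (x + (n : ZMod (2 * n))) = x := by simp [bn, add_assoc, h2]
    rw [hb, aux_firstAfter n (by omega)]
    · right; rfl
    · intro m h0 h1 h
      rcases h with h | h
      · apply hne m (by omega) (by omega)
        simpa using h
      · have h : x + (m : ZMod (2 * n)) = x + n := h
        rw [add_right_inj, aux_cast_eq (by omega) (by omega)] at h
        omega
  refine aux_count_two (fun z => z = x) ?_ x (x + n) (Or.inl rfl) (Or.inr rfl) (by simpa using hnx) ?_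
  · rintro z (rfl | rfl)
    · rw [e1]
    · rw [e2]
  · rintro z (rfl | rfl)
    · left; exact Relation.EqvGen.refl _
    · right; exact Relation.EqvGen.refl _

lemma aux_count_compl (n : ℕ) (hn : 2 ≤ n) (heven : Even n) (x : ZMod (2 * n)) :
    orbitCount n (bn n) ({x, x + (n : ZMod (2 * n))} : Set (ZMod (2 * n)))ᶜ = 2 := by
  haveI : NeZero (2 * n) := ⟨by omega⟩
  have h2 := aux_two n
  set S : Set (ZMod (2 * n)) := ({x, x + (n : ZMod (2 * n))} : Set (ZMod (2 * n)))ᶜ with hS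
  have hmem : ∀ j : ℕ, j < 2 * n → (x + (j : ZMod (2 * n)) ∈ S ↔ j ≠ 0 ∧ j ≠ n) := by
    intro j hj
    have a1 : x + (j : ZMod (2 * n)) = x ↔ j = 0 := by
      rw [add_eq_left, ← Nat.cast_zero, aux_cast_eq hj (by omega)]
    have a2 : x + (j : ZMod (2 * n)) = x + n ↔ j = n := by
      rw [add_right_inj, aux_cast_eq hj (by omega)]
    simp [hS, a1, a2]
  have hmem0 : x ∉ S := by simp [hS]
  have hmemn : x + (n : ZMod (2 * n)) ∉ S := by simp [hS]
  have hrep : ∀ z : ZMod (2 * n), ∃ j : ℕ, j < 2 * n ∧ z = x + (j : ZMod (2 * n)) := by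
    intro z
    exact ⟨(z - x).val, ZMod.val_lt _, by rw [ZMod.natCast_zmod_val]; ring⟩
  -- the four step rules
  have s1 : ∀ j : ℕ, 1 ≤ j → j + 2 ≤ n →
      firstAfter n S (bn n (x + (j : ZMod (2 * n)))) = x + ((n + 1 + j : ℕ) : ZMod (2 * n)) := by
    intro j h0 h1
    have e : bn n (x + (j : ZMod (2 * n))) + ((1 : ℕ) : ZMod (2 * n)) =
      x + ((n + 1 + j : ℕ) : ZMod (2 * n)) := by simp [bn]; ring
    rw [aux_firstAfter 1 one_pos _ (by intros; omega), e]
    rw [e, hmem _ (by omega)]; omega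
  have s2 : firstAfter n S (bn n (x + ((n - 1 : ℕ) : ZMod (2 * n)))) =
      x + ((1 : ℕ) : ZMod (2 * n)) := by
    have e0 : ((n - 1 : ℕ) : ZMod (2 * n)) = n - 1 := by
      rw [Nat.cast_sub (by omega)]; simp
    have e1 : bn n (x + ((n - 1 : ℕ) : ZMod (2 * n))) + ((1 : ℕ) : ZMod (2 * n)) = x := by
      simp only [bn, Equiv.coe_addRight, e0]; linear_combination h2 + (Nat.cast_one : ((1 : ℕ) : ZMod (2 * n)) = 1)
    have e2 : bn n (x + ((n - 1 : ℕ) : ZMod (2 * n))) + ((2 : ℕ) : ZMod (2 * n)) =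
        x + ((1 : ℕ) : ZMod (2 * n)) := by
      simp only [bn, Equiv.coe_addRight, e0]; push_cast; linear_combination h2
    rw [aux_firstAfter 2 two_pos, e2]
    · rw [e2, hmem _ (by omega)]; omega
    · intro m m0 m1
      obtain rfl : m = 1 := by omega
      rw [e1]; exact hmem0
  have s3 : ∀ i : ℕ, i + 3 ≤ n →
      firstAfter n S (bn n (x + ((n + 1 + i : ℕ) : ZMod (2 * n)))) =
        x + ((i + 2 : ℕ) : ZMod (2 * n)) := by
    intro i h1
    have e : bn n (x + ((n + 1 + i : ℕ) : ZMod (2 * n))) + ((1 : ℕ) : ZMod (2 * n)) =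
      x + ((i + 2 : ℕ) : ZMod (2 * n)) := by
      simp only [bn, Equiv.coe_addRight]; push_cast; linear_combination h2
    rw [aux_firstAfter 1 one_pos _ (by intros; omega), e]
    rw [e, hmem _ (by omega)]; omega
  have s4 : firstAfter n S (bn n (x + ((2 * n - 1 : ℕ) : ZMod (2 * n)))) =
      x + ((n + 1 : ℕ) : ZMod (2 * n)) := by
    have e0 : ((2 * n - 1 : ℕ) : ZMod (2 * n)) = - 1 := by
      rw [Nat.cast_sub (by omega)]; simp
    have e1 : bn n (x + ((2 * n - 1 : ℕ) : ZMod (2 * n))) + ((1 : ℕ) : ZMod (2 * n)) = x + n := by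
      simp only [bn, Equiv.coe_addRight, e0]; push_cast; ring
    have e2 : bn n (x + ((2 * n - 1 : ℕ) : ZMod (2 * n))) + ((2 : ℕ) : ZMod (2 * n)) =
        x + ((n + 1 : ℕ) : ZMod (2 * n)) := by
      simp only [bn, Equiv.coe_addRight, e0]; push_cast; ring
    rw [aux_firstAfter 2 two_pos, e2]
    · rw [e2, hmem _ (by omega)]; omega
    · intro m m0 m1
      obtain rfl : m = 1 := by omega
      rw [e1]; exact hmemn
  obtain ⟨t, ht⟩ := heven
  let g : ℕ → Prop := fun j => (j < n ∧ j % 2 = 1) ∨ (n < j ∧ j % 2 = 0)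
  let f : ZMod (2 * n) → Prop := fun z => g (z - x).val
  have hfg : ∀ j : ℕ, j < 2 * n → (f (x + (j : ZMod (2 * n))) ↔ g j) := by
    intro j hj
    simp only [f, add_sub_cancel_left, ZMod.val_natCast_of_lt hj]
  have R1 : ∀ j : ℕ, 1 ≤ j → j + 2 ≤ n → Relation.EqvGen (boundaryStep n (bn n) S)
      (x + (j : ZMod (2 * n))) (x + ((n + 1 + j : ℕ) : ZMod (2 * n))) := fun j h0 h1 =>
    Relation.EqvGen.rel _ _ ⟨(hmem j (by omega)).2 (by omega), (s1 j h0 h1).symm⟩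
  have R3 : ∀ i : ℕ, i + 3 ≤ n → Relation.EqvGen (boundaryStep n (bn n) S)
      (x + ((n + 1 + i : ℕ) : ZMod (2 * n))) (x + ((i + 2 : ℕ) : ZMod (2 * n))) := fun j h1 =>
    Relation.EqvGen.rel _ _ ⟨(hmem _ (by omega)).2 (by omega), (s3 j h1).symm⟩
  have low : ∀ j : ℕ, 1 ≤ j → j < n →
      Relation.EqvGen (boundaryStep n (bn n) S) (x + ((1 : ℕ) : ZMod (2 * n))) (x + (j : ZMod (2 * n))) ∨
      Relation.EqvGen (boundaryStep n (bn n) S) (x + ((n + 1 : ℕ) : ZMod (2 * n)))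
        (x + (j : ZMod (2 * n))) := by
    intro j
    induction j using Nat.strong_induction_on with
    | _ j ih =>
      intro h0 h1
      rcases Nat.lt_or_ge j 3 with h | h
      · obtain rfl | rfl : j = 1 ∨ j = 2 := by omega
        · left; exact Relation.EqvGen.refl _
        · right; exact R3 0 (by omega)
      · obtain ⟨i, rfl⟩ : ∃ i, j = i + 2 := ⟨j - 2, by omega⟩
        have hh := (R1 i (by omega) (by omega)).trans _ _ _ (R3 i (by omega))
        rcases ih i (by omega) (by omega) (by omega) with h | h
        · left; exact h.trans _ _ _ hh
        · right; exact h.trans _ _ _ hh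
  refine aux_count_two f ?_ (x + ((1 : ℕ) : ZMod (2 * n))) (x + ((n + 1 : ℕ) : ZMod (2 * n)))
    ((hmem _ (by omega)).2 (by omega)) ((hmem _ (by omega)).2 (by omega)) ?_ ?_
  · intro z hz
    obtain ⟨j, hj, rfl⟩ := hrep z
    rw [hmem j hj] at hz
    rw [hfg j hj]
    by_cases c1 : j + 2 ≤ n
    · rw [s1 j (by omega) c1, hfg _ (by omega)]; simp only [g]; omega
    by_cases c2 : j = n - 1
    · subst c2
      rw [s2, hfg _ (by omega)]
      exact iff_of_true (Or.inl ⟨by omega, by omega⟩) (Or.inl ⟨by omega, by omega⟩)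
    by_cases c4 : j = 2 * n - 1
    · subst c4
      rw [s4, hfg _ (by omega)]; simp only [g]; omega
    obtain ⟨i, rfl⟩ : ∃ i, j = n + 1 + i := ⟨j - (n + 1), by omega⟩
    rw [s3 i (by omega), hfg _ (by omega)]; simp only [g]; omega
  · rw [hfg _ (by omega), hfg _ (by omega)]
    intro h
    rcases h.1 (Or.inl ⟨by omega, by omega⟩) with h | h <;> omega
  · intro z hz
    obtain ⟨j, hj, rfl⟩ := hrep z
    rw [hmem j hj] at hz
    by_cases c1 : j < n
    · exact low j (by omega) c1
    obtain ⟨i, rfl⟩ : ∃ i, j = n + 1 + i := ⟨j - (n + 1), by omega⟩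
    rcases Nat.eq_zero_or_pos i with rfl | hi
    · right; exact Relation.EqvGen.refl _
    rcases low i hi (by omega) with h | h
    · left; exact h.trans _ _ _ (R1 i hi (by omega))
    · right; exact h.trans _ _ _ (R1 i hi (by omega))

lemma aux_coeff (n : ℕ) (hn : n ≠ 0) (α : Equiv.Perm (ZMod (2 * n))) (S : Set (ZMod (2 * n)))
    (hS : ∀ x ∈ S, α x ∈ S) : (pdPoly n hn α).coeff (pdGenus n α S) ≠ 0 := by
  haveI : NeZero (2 * n) := ⟨by omega⟩
  unfold pdPoly
  rw [Polynomial.finset_sum_coeff]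
  intro h
  rw [Finset.sum_eq_zero_iff] at h
  have := h (Set.toFinite S).toFinset (Finset.mem_univ _)
  rw [if_pos (by simpa using hS)] at this
  simp at this

/-- For even `n ≥ 2`, the partial-dual genus polynomial of `B_n` is not a monomial:
`g(B_n, ∅) = n/2` while `g(B_n, A) = (n − 2)/2` for a single chord `A`; hence `B_n` has
partial duals of different genera. -/
theorem Bn_even_not_monomial (n : ℕ) (hn : 2 ≤ n) (heven : Even n) :
    pdGenus n (bn n) ∅ = n / 2 ∧
    (∀ x : ZMod (2 * n),
      pdGenus n (bn n) ({x, x + (n : ZMod (2 * n))} : Set (ZMod (2 * n))) = (n - 2) / 2) ∧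
    (¬ ∃ (c k : ℕ), pdPoly n (by omega) (bn n) = Polynomial.C c * Polynomial.X ^ k) ∧
    (∃ S T : Set (ZMod (2 * n)), (∀ x ∈ S, bn n x ∈ S) ∧ (∀ x ∈ T, bn n x ∈ T) ∧
      pdGenus n (bn n) S ≠ pdGenus n (bn n) T) := by
  have A : pdGenus n (bn n) ∅ = n / 2 := by
    unfold pdGenus
    rw [Set.compl_empty, aux_count_univ n hn heven]
    simp [orbitCount]
  have B : ∀ x : ZMod (2 * n),
      pdGenus n (bn n) ({x, x + (n : ZMod (2 * n))} : Set (ZMod (2 * n))) = (n - 2) / 2 := by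
    intro x
    unfold pdGenus
    rw [aux_count_pair n hn, aux_count_compl n hn heven]
    congr 1; omega
  have hne : n / 2 ≠ (n - 2) / 2 := by omega
  have i1 : ∀ x ∈ (∅ : Set (ZMod (2 * n))), bn n x ∈ (∅ : Set (ZMod (2 * n))) := by simp
  have i2 : ∀ x ∈ ({0, 0 + (n : ZMod (2 * n))} : Set (ZMod (2 * n))),
      bn n x ∈ ({0, 0 + (n : ZMod (2 * n))} : Set (ZMod (2 * n))) := by
    rintro x (rfl | rfl)
    · right; rfl
    · left; simp [bn, aux_two]
  refine ⟨A, B, ?_, ∅, {0, 0 + (n : ZMod (2 * n))}, i1, i2, by rw [A, B]; exact hne⟩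
  rintro ⟨c, k, h⟩
  have c1 := aux_coeff n (by omega) (bn n) _ i1
  have c2 := aux_coeff n (by omega) (bn n) _ i2
  rw [A, h, Polynomial.coeff_C_mul_X_pow] at c1
  rw [B, h, Polynomial.coeff_C_mul_X_pow] at c2
  simp only [ne_eq, ite_eq_right_iff, Classical.not_imp] at c1 c2
  exact hne (c1.1.trans c2.1.symm)
end

section
/- Let n ≥ 1 and let α be a chord diagram of order n in which every two distinct chords interlace (the interlacement graph is the complete graph K_n). Then α x = x + n for every x ∈ ZMod (2n); that is, B_n is the unique one-vertex ribbon graph whose chord diagram has complete intersection graph K_n. -/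
open scoped Classical

/-- `B_n` is the unique chord diagram of order `n` whose interlacement graph is the
complete graph `K_n`: if every two distinct chords of `α` interlace, then `α x = x + n`
for every `x`. -/
theorem complete_interlacement_is_Bn (n : ℕ) (hn : 1 ≤ n) (α : Equiv.Perm (ZMod (2 * n)))
    (hinv : ∀ x, α (α x) = x) (hfree : ∀ x, α x ≠ x)
    (hcomplete : ∀ x y : ZMod (2 * n), (y ≠ x ∧ y ≠ α x) → Interlaces n α x y) :
    ∀ x : ZMod (2 * n), α x = x + (n : ZMod (2 * n)) := by
  intro x
  haveI : NeZero (2 * n) := ⟨by omega⟩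
  set m := (α x - x).val with hm
  have hm0 : m ≠ 0 := by
    intro h
    exact hfree x (sub_eq_zero.mp ((ZMod.val_eq_zero _).mp h))
  have hm2 : m < 2 * n := ZMod.val_lt _
  have hcast : ∀ k : ℕ, k < 2 * n → ((x + (k : ZMod (2 * n))) - x).val = k := by
    intro k hk
    rw [add_sub_cancel_left, ZMod.val_natCast_of_lt hk]
  have key : ∀ k : ℕ, k < 2 * n → k ≠ 0 → k ≠ m →
      ((α (x + (k : ZMod (2 * n))) - x).val ≠ 0 ∧ (α (x + (k : ZMod (2 * n))) - x).val ≠ m ∧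
       ((α (x + (k : ZMod (2 * n))) - x).val < m ↔ ¬ k < m)) := by
    intro k hk h0 h1
    have hv := hcast k hk
    generalize x + (k : ZMod (2 * n)) = y at hv
    have hyx : y ≠ x := by
      rintro rfl
      simp at hv
      exact h0 hv.symm
    have hya : y ≠ α x := by
      rintro rfl
      exact h1 hv.symm
    have hI := hcomplete x y ⟨hyx, hya⟩
    have e0 : (α y - x).val ≠ 0 := by
      intro h
      have h2 := sub_eq_zero.mp ((ZMod.val_eq_zero _).mp h)
      apply hya
      rw [← h2, hinv]
    have e1 : (α y - x).val ≠ m := by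
      intro h
      have h2 := ZMod.val_injective _ h
      exact hyx (α.injective (sub_left_injective h2))
    refine ⟨e0, e1, ?_⟩
    unfold Interlaces Xor' at hI
    simp only [Xor, xor_def] at hI
    rw [hv, ← hm] at hI
    omega
  have hinj : ∀ k < 2 * n, ∀ l < 2 * n, (α (x + (k : ZMod (2 * n))) - x).val =
      (α (x + (l : ZMod (2 * n))) - x).val → k = l := by
    intro k hk l hl h
    have h2 := α.injective (sub_left_injective (ZMod.val_injective _ h))
    rw [← hcast k hk, ← hcast l hl, h2]
  have c1 : (Finset.Ioo 0 m).card ≤ (Finset.Ioo m (2 * n)).card := by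
    apply Finset.card_le_card_of_injOn (fun k : ℕ => (α (x + (k : ZMod (2 * n))) - x).val)
    · intro k hk
      simp only [Finset.coe_Ioo, Set.mem_Ioo] at hk ⊢
      have := key k (by omega) (by omega) (by omega)
      have h3 := ZMod.val_lt (α (x + (k : ZMod (2 * n))) - x)
      omega
    · intro k hk l hl h
      simp only [Finset.coe_Ioo, Set.mem_Ioo] at hk hl
      exact hinj k (by omega) l (by omega) h
  have c2 : (Finset.Ioo m (2 * n)).card ≤ (Finset.Ioo 0 m).card := by
    apply Finset.card_le_card_of_injOn (fun k : ℕ => (α (x + (k : ZMod (2 * n))) - x).val)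
    · intro k hk
      simp only [Finset.coe_Ioo, Set.mem_Ioo] at hk ⊢
      have := key k (by omega) (by omega) (by omega)
      omega
    · intro k hk l hl h
      simp only [Finset.coe_Ioo, Set.mem_Ioo] at hk hl
      exact hinj k (by omega) l (by omega) h
  rw [Nat.card_Ioo, Nat.card_Ioo] at c1 c2
  have hmn : m = n := by omega
  have h4 : ((m : ℕ) : ZMod (2 * n)) = α x - x := ZMod.natCast_zmod_val _
  rw [hmn] at h4
  rw [h4]
  ring
end
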